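/- Let K be a convex body in ℝ² that is a twofold translative tile. Then K is a centrally symmetric polygon with at most 6 edges. -/

import Mathlib

open Pointwise
/-- A convex body in ℝⁿ: a compact convex set with nonempty interior. -/
def IsConvexBody {n : ℕ} (K : Set (EuclideanSpace ℝ (Fin n))) : Prop :=
  IsCompact K ∧ Convex ℝ K ∧ (interior K).Nonempty

/-- `K` is a `k`-fold translative tile: there is a (locally finite) multiset of translation
vectors, encoded as a family `x : ι → ℝⁿ`, such that every point of `ℝⁿ` not on the boundary
of any translate lies in exactly `k` translates, counted with multiplicity. -/
def IsKFoldTranslativeTile {n : ℕ} (K : Set (EuclideanSpace ℝ (Fin n))) (k : ℕ) : Prop :=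
  ∃ (ι : Type) (x : ι → EuclideanSpace ℝ (Fin n)),
    (∀ B : Set (EuclideanSpace ℝ (Fin n)), Bornology.IsBounded B →
        {i | ((x i +ᵥ K) ∩ B).Nonempty}.Finite) ∧
    ∀ p : EuclideanSpace ℝ (Fin n),
      (∀ i, p ∉ frontier (x i +ᵥ K)) → {i | p ∈ x i +ᵥ K}.encard = k

open Set MeasureTheory

/-- The Euclidean plane. -/
abbrev Plane := EuclideanSpace ℝ (Fin 2)

/-- A locally finite family of closed convex sets with nonempty interiors that covers every point
of the plane at least twice, and no point more than twice by interiors. -/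
structure IsDoubleCover {ι : Type} (T : ι → Set Plane) : Prop where
  convex : ∀ i, Convex ℝ (T i)
  isClosed : ∀ i, IsClosed (T i)
  interior_nonempty : ∀ i, (interior (T i)).Nonempty
  finite_meet : ∀ B : Set Plane, Bornology.IsBounded B → {i | (T i ∩ B).Nonempty}.Finite
  not_triple : ∀ p i j k, i ≠ j → i ≠ k → j ≠ k →
    p ∈ interior (T i) → p ∈ interior (T j) → p ∈ interior (T k) → False
  exists_pair : ∀ p, ∃ i j, i ≠ j ∧ p ∈ T i ∧ p ∈ T j

lemma countable_of_finite_meet {ι : Type} {T : ι → Set Plane}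
    (hne : ∀ i, (T i).Nonempty)
    (hfin : ∀ B : Set Plane, Bornology.IsBounded B → {i | (T i ∩ B).Nonempty}.Finite) :
    Countable ι := by
  have h : (Set.univ : Set ι) ⊆ ⋃ n : ℕ, {i | (T i ∩ Metric.ball 0 n).Nonempty} := by
    intro i _
    obtain ⟨y, hy⟩ := hne i
    obtain ⟨n, hn⟩ := exists_nat_gt ‖y‖
    exact mem_iUnion.2 ⟨n, y, hy, by simpa using hn⟩
  rw [← Set.countable_univ_iff]
  exact (Set.countable_iUnion fun n => (hfin _ Metric.isBounded_ball).countable).mono h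

/-- In a locally finite closed family, sets meeting a small ball around `p` contain `p`. -/
lemma exists_ball_meet_imp_mem {ι : Type} {T : ι → Set Plane}
    (hcl : ∀ i, IsClosed (T i))
    (hfin : ∀ B : Set Plane, Bornology.IsBounded B → {i | (T i ∩ B).Nonempty}.Finite)
    (p : Plane) : ∃ ε > 0, ∀ i, ∀ y ∈ T i, dist y p < ε → p ∈ T i := by
  have hF := hfin (Metric.ball p 1) Metric.isBounded_ball
  set F := {i | (T i ∩ Metric.ball p 1).Nonempty}
  have hF' : (F ∩ {i | p ∉ T i}).Finite := hF.inter_of_left _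
  have hc : IsClosed (⋃ i ∈ F ∩ {i | p ∉ T i}, T i) := hF'.isClosed_biUnion fun i _ => hcl i
  have hp : p ∈ (⋃ i ∈ F ∩ {i | p ∉ T i}, T i)ᶜ := by simp
  obtain ⟨ε, hε, hb⟩ := Metric.isOpen_iff.1 hc.isOpen_compl p hp
  refine ⟨min ε 1, by positivity, fun i y hy hd => ?_⟩
  by_contra hpi
  refine hb (Metric.mem_ball.2 (hd.trans_le (min_le_left _ _))) ?_
  exact mem_biUnion (x := i) ⟨⟨y, hy, Metric.mem_ball.2 (hd.trans_le (min_le_right _ _))⟩, hpi⟩ hy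

lemma IsConvexBody.isDoubleCover {K : Set Plane} (hK : IsConvexBody K)
    {ι : Type} {x : ι → Plane}
    (hfin : ∀ B : Set Plane, Bornology.IsBounded B → {i | ((x i +ᵥ K) ∩ B).Nonempty}.Finite)
    (h2 : ∀ p : Plane, (∀ i, p ∉ frontier (x i +ᵥ K)) → {i | p ∈ x i +ᵥ K}.encard = 2) :
    IsDoubleCover (fun i => x i +ᵥ K) := by
  obtain ⟨hcomp, hconv, hint⟩ := hK
  have hconvT : ∀ i, Convex ℝ (x i +ᵥ K) := fun i => hconv.vadd (x i)
  have hclT : ∀ i, IsClosed (x i +ᵥ K) := fun i => hcomp.isClosed.vadd (x i)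
  have hneT : ∀ i, (x i +ᵥ K).Nonempty := fun i => (hint.mono interior_subset).vadd_set
  have : Countable ι := countable_of_finite_meet hneT hfin
  have hdense : Dense {p : Plane | ∀ i, p ∉ frontier (x i +ᵥ K)} := by
    apply Measure.dense_of_ae (μ := volume)
    rw [ae_all_iff]
    intro i
    exact measure_eq_zero_iff_ae_notMem.1 ((hconvT i).addHaar_frontier volume)
  refine ⟨hconvT, hclT, ?_, hfin, ?_, ?_⟩
  · intro i
    rw [interior_vadd]
    exact hint.vadd_set
  · intro p i j k hij hik hjk hi hj hk
    obtain ⟨q, hq, hqd⟩ := hdense.exists_mem_open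
      (isOpen_interior.inter (isOpen_interior.inter isOpen_interior)) ⟨p, hi, hj, hk⟩
    have hsub : ({i, j, k} : Set ι) ⊆ {i | q ∈ x i +ᵥ K} := by
      rintro l (rfl | rfl | rfl)
      · exact mem_ofPred.2 (interior_subset hqd.1)
      · exact mem_ofPred.2 (interior_subset hqd.2.1)
      · exact mem_ofPred.2 (interior_subset hqd.2.2)
    have h3 : ({i, j, k} : Set ι).encard = 3 := by
      rw [encard_insert_of_notMem (by simp [hij, hik]), encard_pair hjk]; norm_num
    have := encard_le_encard hsub
    rw [h3, h2 q hq] at this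
    exact absurd this (by decide)
  · intro p
    obtain ⟨ε, hε, hb⟩ := exists_ball_meet_imp_mem hclT hfin p
    obtain ⟨q, hq, hqd⟩ := hdense.exists_mem_open Metric.isOpen_ball ⟨p, Metric.mem_ball_self hε⟩
    have h1 : 1 < {i | q ∈ x i +ᵥ K}.encard := by rw [h2 q hq]; decide
    obtain ⟨i, j, hi, hj, hij⟩ := one_lt_encard_iff.1 h1
    exact ⟨i, j, hij, hb i q hi (Metric.mem_ball.1 hqd), hb j q hj (Metric.mem_ball.1 hqd)⟩

lemma exists_apply_ne_zero {g : Plane →L[ℝ] ℝ} (hg : g ≠ 0) : ∃ u, g u ≠ 0 := by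
  by_contra! hcon
  exact hg (ContinuousLinearMap.ext hcon)

lemma exists_ker_span (f : Plane →L[ℝ] ℝ) {u : Plane} (hu : f u ≠ 0) :
    ∃ e : Plane, e ≠ 0 ∧ f e = 0 ∧ ∀ v, f v = 0 → ∃ s : ℝ, v = s • e := by
  have h1 : Module.finrank ℝ (LinearMap.ker (f : Plane →ₗ[ℝ] ℝ)) = 1 := by
    have := LinearMap.finrank_range_add_finrank_ker (f : Plane →ₗ[ℝ] ℝ)
    have hr : LinearMap.range (f : Plane →ₗ[ℝ] ℝ) = ⊤ :=
      LinearMap.range_eq_top.2 (LinearMap.surjective fun h => hu (by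
        simpa using DFunLike.congr_fun h u))
    rw [hr] at this
    simp at this
    omega
  obtain ⟨e, he, hs⟩ := finrank_eq_one_iff'.1 h1
  refine ⟨e, by simpa using he, e.2, fun v hv => ?_⟩
  obtain ⟨c, hc⟩ := hs ⟨v, hv⟩
  exact ⟨c, by simpa using (congrArg Subtype.val hc).symm⟩

/-- Two convex sets that both reach from the lower side of a line to the same side of the point `p`
on that line overlap near `p` inside any third convex set met by both below the line. -/
lemma exists_mem_three_interiors {A B C : Set Plane} (hA : Convex ℝ A) (hB : Convex ℝ B)
    (hC : Convex ℝ C) {p e : Plane} {f : Plane →L[ℝ] ℝ}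
    (hk : ∀ v, f v = 0 → ∃ s : ℝ, v = s • e)
    (hpA : p ∈ A) (hpB : p ∈ B) (hpC : p ∈ C)
    {c c' : ℝ} (hc : 0 < c) (hc' : 0 < c') (hcA : p + c • e ∈ A) (hcB : p + c' • e ∈ B)
    {a b : Plane} (haA : a ∈ interior A) (haC : a ∈ interior C) (hbB : b ∈ interior B)
    (hbC : b ∈ interior C) (hfa : f a < f p) (hfb : f b < f p) :
    ∃ w, w ∈ interior A ∧ w ∈ interior B ∧ w ∈ interior C := by
  have key : ∀ {A B : Set Plane}, Convex ℝ A → Convex ℝ B → p ∈ A → p ∈ B → ∀ {c' : ℝ}, 0 < c' →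
      p + c' • e ∈ B → ∀ {a b : Plane}, a ∈ interior A → a ∈ interior C → b ∈ interior B →
      f a < f p → f b < f p → ∀ s : ℝ, 0 ≤ s →
      (f p - f b) • (a - p) = (f p - f a) • (b - p) + s • e →
      ∃ w, w ∈ interior A ∧ w ∈ interior B ∧ w ∈ interior C := by
    intro A B hA hB hpA hpB c' hc' hcB a b haA haC hbB hfa hfb s hs hab
    set α := f p - f a with hα
    set β := f p - f b with hβ
    have hα0 : 0 < α := by linarith
    have hβ0 : 0 < β := by linarith
    have hD : 0 < s + c' * α := by positivity
    set θ := c' * α / (s + c' * α) with hθ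
    have hθ0 : 0 < θ := by positivity
    have hθ1 : 0 ≤ 1 - θ := by
      rw [hθ, sub_nonneg, div_le_one hD]; linarith
    have hy : (1 - θ) • (p + c' • e) + θ • b ∈ interior B :=
      hB.combo_self_interior_mem_interior hcB hbB hθ1 hθ0 (by ring)
    have hy' : (1 - θ) • (p + c' • e) + θ • b = p + (θ / α * β) • (a - p) := by
      have : (θ / α * β) • (a - p) = (θ / α) • (α • (b - p) + s • e) := by
        rw [← hab, smul_smul]
      have h1 : θ / α * s = (1 - θ) * c' := by
        rw [hθ]; field_simp; ring
      rw [this, smul_add (θ / α), smul_smul, smul_smul (θ / α), div_mul_cancel₀ _ hα0.ne', h1]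
      module
    rw [hy'] at hy
    set k := θ / α * β with hk
    have hk0 : 0 < k := by positivity
    set t := min 1 (1 / k)
    have ht0 : 0 < t := by positivity
    have ht1 : t ≤ 1 := min_le_left _ _
    have htk : t * k ≤ 1 := by
      calc t * k ≤ 1 / k * k := by gcongr; exact min_le_right _ _
        _ = 1 := by field_simp
    refine ⟨p + (t * k) • (a - p), ?_, ?_, ?_⟩
    · exact hA.add_smul_sub_mem_interior hpA haA ⟨by positivity, htk⟩
    · rw [mul_smul]
      exact hB.add_smul_mem_interior hpB hy ⟨ht0, ht1⟩
    · exact hC.add_smul_sub_mem_interior hpC haC ⟨by positivity, htk⟩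
  obtain ⟨s, hs⟩ := hk ((f p - f b) • (a - p) - (f p - f a) • (b - p)) (by simp; ring)
  rcases le_total 0 s with h | h
  · exact key hA hB hpA hpB hc' hcB haA haC hbB hfa hfb s h (by rw [← hs]; abel)
  · obtain ⟨w, h1, h2, h3⟩ := key hB hA hpB hpA hc hcA hbB hbC haA hfb hfa (-s) (by linarith)
      (by rw [neg_smul, ← hs]; abel)
    exact ⟨w, h2, h1, h3⟩

/-- A line through `p` that strictly supports the set near a common boundary point is crossed in
the interior by every convex set reaching to both sides. -/
lemma exists_add_smul_mem_interior {A : Set Plane} (hA : Convex ℝ A) {p e : Plane}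
    {f : Plane →L[ℝ] ℝ} (hk : ∀ v, f v = 0 → ∃ s : ℝ, v = s • e) {y z : Plane} (hy : y ∈ A)
    (hz : z ∈ interior A) (hfy : f p < f y) (hfz : f z < f p) :
    ∃ s : ℝ, p + s • e ∈ interior A := by
  have hD : 0 < f y - f z := by linarith
  set θ := (f y - f p) / (f y - f z) with hθ
  have hθ0 : 0 < θ := div_pos (by linarith) hD
  have hθ1 : 0 ≤ 1 - θ := by rw [hθ, sub_nonneg, div_le_one hD]; linarith
  have h := hA.combo_self_interior_mem_interior hy hz hθ1 hθ0 (by ring)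
  obtain ⟨s, hs⟩ := hk ((1 - θ) • y + θ • z - p) (by
    simp only [map_sub, map_add, map_smul, smul_eq_mul]
    rw [hθ]; field_simp; ring)
  exact ⟨s, by rw [← hs]; simpa using h⟩

namespace IsDoubleCover

variable {ι : Type} {T : ι → Set Plane}

lemma subset_closure_interior (hT : IsDoubleCover T) (i : ι) :
    T i ⊆ closure (interior (T i)) := by
  rw [(hT.convex i).closure_interior_eq_closure_of_nonempty_interior (hT.interior_nonempty i)]
  exact subset_closure

/-- Every boundary point of a member of a double cover lies in another member that does not
overlap it. -/
theorem exists_disjoint_neighbour (hT : IsDoubleCover T) {i : ι} {p : Plane} (hp : p ∈ T i)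
    (hpi : p ∉ interior (T i)) :
    ∃ j, p ∈ T j ∧ Disjoint (interior (T i)) (interior (T j)) := by
  by_contra! hcon
  have hov : ∀ j, p ∈ T j → ∃ z, z ∈ interior (T i) ∧ z ∈ interior (T j) := fun j hj =>
    not_disjoint_iff.1 (hcon j hj)
  obtain ⟨f, hf⟩ := geometric_hahn_banach_open_point (hT.convex i).interior isOpen_interior hpi
  obtain ⟨a, ha⟩ := hT.interior_nonempty i
  have hu : 0 < f (p - a) := by simpa using hf a ha
  set u := p - a
  obtain ⟨e, he0, he, hk⟩ := exists_ker_span f hu.ne'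
  have hle : ∀ y ∈ T i, f y ≤ f p := fun y hy =>
    closure_minimal (fun z hz => (hf z hz).le) (isClosed_le f.continuous continuous_const)
      (hT.subset_closure_interior i hy)
  set U : Set ι := {j | p ∈ T j ∧ ∃ y ∈ T j, f p < f y} with hU
  have hiU : ∀ j ∈ U, i ≠ j := by
    rintro j ⟨-, y, hy, hfy⟩ rfl
    exact absurd (hle y hy) (not_le.2 hfy)
  have huniq : ∀ d : Plane, (∀ v, f v = 0 → ∃ s : ℝ, v = s • d) → ∀ j ∈ U, ∀ k ∈ U,
      (∃ c : ℝ, 0 < c ∧ p + c • d ∈ T j) → (∃ c : ℝ, 0 < c ∧ p + c • d ∈ T k) → j = k := by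
    rintro d hkd j hj k hk ⟨c, hc, hcj⟩ ⟨c', hc', hck⟩
    by_contra hjk
    obtain ⟨a, hai, haj⟩ := hov j hj.1
    obtain ⟨b, hbi, hbk⟩ := hov k hk.1
    obtain ⟨w, hw1, hw2, hw3⟩ := exists_mem_three_interiors (hT.convex j) (hT.convex k)
      (hT.convex i) hkd hj.1 hk.1 hp hc hc' hcj hck haj hai hbk hbi (hf a hai) (hf b hbi)
    exact hT.not_triple w i j k (hiU j hj) (hiU k hk) hjk hw3 hw1 hw2
  have hkn : ∀ v, f v = 0 → ∃ s : ℝ, v = s • (-e) := fun v hv => by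
    obtain ⟨s, hs⟩ := hk v hv
    exact ⟨-s, by simpa using hs⟩
  have hright := huniq e hk
  have hleft := huniq (-e) hkn
  have hside : ∀ j ∈ U, (∃ c : ℝ, 0 < c ∧ p + c • e ∈ T j) ∨
      (∃ c : ℝ, 0 < c ∧ p + c • (-e) ∈ T j) := by
    rintro j ⟨hpj, y, hy, hfy⟩
    obtain ⟨z, hzi, hzj⟩ := hov j hpj
    obtain ⟨s, hs⟩ := exists_add_smul_mem_interior (hT.convex j) hk hy hzj hfy (hf z hzi)
    rcases lt_trichotomy s 0 with h | rfl | h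
    · exact Or.inr ⟨-s, by linarith, by simpa using interior_subset hs⟩
    · left
      have hcont : Filter.Tendsto (fun c : ℝ => p + c • e) (nhdsWithin 0 (Ioi 0))
          (nhds (p + (0 : ℝ) • e)) :=
        (Continuous.tendsto (by fun_prop) 0).mono_left nhdsWithin_le_nhds
      obtain ⟨c, hc, hc0⟩ := ((hcont.eventually (isOpen_interior.mem_nhds hs)).and
        self_mem_nhdsWithin).exists
      exact ⟨c, hc0, interior_subset hc⟩
    · exact Or.inl ⟨s, h, interior_subset hs⟩
  obtain ⟨ε, hε, hb⟩ := exists_ball_meet_imp_mem hT.isClosed hT.finite_meet p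
  have hpair : ∀ y, dist y p < ε → f p < f y → ∃ j ∈ U, ∃ k ∈ U, j ≠ k ∧ y ∈ T j ∧ y ∈ T k := by
    intro y hy hfy
    obtain ⟨j, k, hjk, hj, hk⟩ := hT.exists_pair y
    exact ⟨j, ⟨hb j y hj hy, y, hj, hfy⟩, k, ⟨hb k y hk hy, y, hk, hfy⟩, hjk, hj, hk⟩
  obtain ⟨c, hc0, hc⟩ : ∃ c : ℝ, 0 < c ∧ dist (p + c • e) p < ε := by
    refine ⟨ε / 2 / ‖e‖, by positivity, ?_⟩
    have : 0 < ‖e‖ := by positivity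
    rw [dist_self_add_left, norm_smul, Real.norm_of_nonneg (by positivity)]
    field_simp
    linarith
  have hcont : Filter.Tendsto (fun δ : ℝ => p + c • e + δ • u) (nhdsWithin 0 (Ioi 0))
      (nhds (p + c • e)) := by
    have : Filter.Tendsto (fun δ : ℝ => p + c • e + δ • u) (nhds 0)
        (nhds (p + c • e + (0 : ℝ) • u)) := Continuous.tendsto (by fun_prop) 0
    simp only [zero_smul, add_zero] at this
    exact this.mono_left nhdsWithin_le_nhds
  have hev : ∀ᶠ δ : ℝ in nhdsWithin 0 (Ioi 0),
      dist (p + c • e + δ • u) p < ε ∧ f p < f (p + c • e + δ • u) := by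
    filter_upwards [hcont.eventually (Metric.isOpen_ball.mem_nhds (Metric.mem_ball.2 hc)),
      self_mem_nhdsWithin] with δ h1 h2
    refine ⟨h1, ?_⟩
    have : 0 < δ * f u := mul_pos h2 hu
    simpa [he] using this
  obtain ⟨δ, hδ⟩ := hev.exists
  have main : ∃ j ∈ U, ∃ k ∈ U, j ≠ k ∧ (∃ c : ℝ, 0 < c ∧ p + c • e ∈ T j) ∧
      (∃ c : ℝ, 0 < c ∧ p + c • (-e) ∈ T k) := by
    obtain ⟨j, hj, k, hk, hjk, -, -⟩ := hpair _ hδ.1 hδ.2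
    rcases hside j hj with h1 | h1 <;> rcases hside k hk with h2 | h2
    · exact absurd (hright j hj k hk h1 h2) hjk
    · exact ⟨j, hj, k, hk, hjk, h1, h2⟩
    · exact ⟨k, hk, j, hj, hjk.symm, h2, h1⟩
    · exact absurd (hleft j hj k hk h1 h2) hjk
  obtain ⟨j, hj, k, hk, hjk, hjr, hkl⟩ := main
  have hmem : p + c • e ∈ T k := by
    refine (hT.isClosed k).mem_of_tendsto hcont ?_
    filter_upwards [hev] with δ hδ
    obtain ⟨j', hj', k', hk', hjk', hyj, hyk⟩ := hpair _ hδ.1 hδ.2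
    rcases hside j' hj' with h1 | h1
    · rcases hside k' hk' with h2 | h2
      · exact absurd (hright j' hj' k' hk' h1 h2) hjk'
      · rwa [hleft k' hk' k hk h2 hkl] at hyk
    · rwa [hleft j' hj' k hk h1 hkl] at hyj
  exact hjk (hright j hj k hk hjr ⟨c, hc0, hmem⟩)

end IsDoubleCover

/-- `A` has two opposite parallel edges with outer normals `±f`, both translates of the segment
from `0` to `e`. -/
def HasEdgePair (A : Set Plane) (f : StrongDual ℝ Plane) (e : Plane) : Prop :=
  e ≠ 0 ∧ f e = 0 ∧ ∃ q r, f.toExposed A = segment ℝ q (q + e) ∧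
    (-f).toExposed A = segment ℝ r (r + e)

lemma mem_segment_add {q e x : Plane} :
    x ∈ segment ℝ q (q + e) ↔ ∃ s : ℝ, 0 ≤ s ∧ s ≤ 1 ∧ x = q + s • e := by
  rw [segment_eq_image']
  simp only [mem_image, mem_Icc, add_sub_cancel_left]
  constructor
  · rintro ⟨s, ⟨h0, h1⟩, rfl⟩; exact ⟨s, h0, h1, rfl⟩
  · rintro ⟨s, h0, h1, rfl⟩; exact ⟨s, ⟨h0, h1⟩, rfl⟩

lemma left_mem_extremePoints_segment {q e : Plane} (he : e ≠ 0) :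
    q ∈ (segment ℝ q (q + e)).extremePoints ℝ := by
  refine mem_extremePoints_iff_left.2 ⟨left_mem_segment ℝ _ _, ?_⟩
  intro x₁ h₁ x₂ h₂ hq
  obtain ⟨a, ha0, -, rfl⟩ := mem_segment_add.1 h₁
  obtain ⟨b, hb0, -, rfl⟩ := mem_segment_add.1 h₂
  obtain ⟨s, t, hs, ht, hst, h⟩ := hq
  have : (s * a + t * b) • e = 0 := by
    have h' : s • (q + a • e) + t • (q + b • e) = (s + t) • q + (s * a + t * b) • e := by module
    rw [h', hst, one_smul] at h
    simpa using h
  have h0 : s * a + t * b = 0 := (smul_eq_zero.1 this).resolve_right he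
  have : a = 0 := by nlinarith [mul_nonneg hs.le ha0, mul_nonneg ht.le hb0]
  simp [this]

lemma right_mem_extremePoints_segment {q e : Plane} (he : e ≠ 0) :
    q + e ∈ (segment ℝ q (q + e)).extremePoints ℝ := by
  have := left_mem_extremePoints_segment (q := q + e) (e := -e) (by simpa using he)
  rwa [segment_symm, show q + e + -e = q by abel] at this

lemma toExposed_isExtreme (f : StrongDual ℝ Plane) (A : Set Plane) :
    IsExtreme ℝ A (f.toExposed A) :=
  ContinuousLinearMap.toExposed.isExposed.isExtreme

namespace HasEdgePair

variable {A : Set Plane} {f : StrongDual ℝ Plane} {e : Plane}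

lemma exists_faces (h : HasEdgePair A f e) : ∃ q r,
    q ∈ A ∧ q + e ∈ A ∧ r ∈ A ∧ r + e ∈ A ∧ (∀ y ∈ A, f y ≤ f q) ∧ (∀ y ∈ A, f r ≤ f y) := by
  obtain ⟨-, -, q, r, hq, hr⟩ := h
  have h1 : q ∈ f.toExposed A := hq ▸ left_mem_segment ℝ _ _
  have h2 : q + e ∈ f.toExposed A := hq ▸ right_mem_segment ℝ _ _
  have h3 : r ∈ (-f).toExposed A := hr ▸ left_mem_segment ℝ _ _
  have h4 : r + e ∈ (-f).toExposed A := hr ▸ right_mem_segment ℝ _ _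
  exact ⟨q, r, h1.1, h2.1, h3.1, h4.1, h1.2, fun y hy => by simpa using h3.2 y hy⟩

/-- Every chord parallel to a pair of opposite edges contains a translate of these edges. -/
lemma exists_chord (h : HasEdgePair A f e) (hA : Convex ℝ A) {v : Plane} (hv : v ∈ A) :
    ∃ w, w ∈ A ∧ w + e ∈ A ∧ f w = f v := by
  obtain ⟨q, r, hq, hqe, hr, hre, hmax, hmin⟩ := h.exists_faces
  rcases (hmin q hq).eq_or_lt with heq | hlt
  · exact ⟨q, hq, hqe, le_antisymm (heq ▸ hmin v hv) (hmax v hv)⟩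
  · have hD : 0 < f q - f r := by linarith
    set l := (f v - f r) / (f q - f r) with hl
    have hl0 : 0 ≤ l := div_nonneg (by linarith [hmin v hv]) hD.le
    have hl1 : 0 ≤ 1 - l := by
      rw [hl, sub_nonneg, div_le_one hD]; linarith [hmax v hv]
    refine ⟨(1 - l) • r + l • q, hA hr hq hl1 hl0 (by ring), ?_, ?_⟩
    · have := hA hre hqe hl1 hl0 (by ring)
      convert this using 1
      module
    · simp only [map_add, map_smul, smul_eq_mul]
      rw [hl]; field_simp; ring

lemma exists_add_smul_mem (h : HasEdgePair A f e) (hA : Convex ℝ A) {v : Plane} (hv : v ∈ A) :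
    ∃ s : ℝ, s ≠ 0 ∧ v + s • e ∈ A := by
  obtain ⟨w, hw, hwe, hfw⟩ := h.exists_chord hA hv
  obtain ⟨he0, hfe, q, r, hq, -⟩ := h
  rcases eq_or_ne w v with rfl | hne
  · exact ⟨1, one_ne_zero, by simpa using hwe⟩
  · by_cases hf : f = 0
    · subst hf
      have hmem : ∀ y ∈ A, y ∈ segment ℝ q (q + e) := fun y hy => by
        rw [← hq]; exact ⟨hy, fun z hz => by simp⟩
      obtain ⟨a, -, -, ha⟩ := mem_segment_add.1 (hmem v hv)
      obtain ⟨b, -, -, hb⟩ := mem_segment_add.1 (hmem w hw)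
      refine ⟨b - a, ?_, ?_⟩
      · intro hab; apply hne; rw [ha, hb, sub_eq_zero.1 hab]
      · have : v + (b - a) • e = w := by rw [ha, hb]; module
        rwa [this]
    · obtain ⟨u, hu⟩ := exists_apply_ne_zero hf
      obtain ⟨d, hd0, hfd, hk⟩ := exists_ker_span f hu
      obtain ⟨a, ha⟩ := hk e hfe
      obtain ⟨b, hb⟩ := hk (w - v) (by simp [hfw])
      have ha0 : a ≠ 0 := fun h => he0 (by simp [ha, h])
      have hb0 : b ≠ 0 := fun h => hne (sub_eq_zero.1 (by simp [hb, h]))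
      refine ⟨b / a, div_ne_zero hb0 ha0, ?_⟩
      have : v + (b / a) • e = w := by
        rw [ha, smul_smul, div_mul_cancel₀ _ ha0, ← hb]; abel
      rwa [this]

end HasEdgePair

/-- If `f₁ e₁ = 0`, `f₂ e₂ = 0` with `f₁`, `f₂` having independent kernels, then a functional
vanishing at both `e₁` and `e₂` is zero. -/
lemma eq_zero_of_apply_eq_zero {f₁ f₂ : StrongDual ℝ Plane}
    (hpar : ∀ x, f₁ x = 0 → f₂ x = 0 → x = 0) {e₁ e₂ : Plane} (h₁ : f₁ e₁ = 0) (h₂ : f₂ e₂ = 0)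
    (he₁ : e₁ ≠ 0) (he₂ : e₂ ≠ 0) {g : StrongDual ℝ Plane} (hg₁ : g e₁ = 0) (hg₂ : g e₂ = 0) :
    g = 0 := by
  by_contra hg
  obtain ⟨u, hu⟩ := exists_apply_ne_zero hg
  obtain ⟨d, hd0, -, hk⟩ := exists_ker_span g hu
  obtain ⟨a, ha⟩ := hk e₁ hg₁
  obtain ⟨b, hb⟩ := hk e₂ hg₂
  have ha0 : a ≠ 0 := fun h => he₁ (by simp [ha, h])
  have hb0 : b ≠ 0 := fun h => he₂ (by simp [hb, h])
  refine hd0 (hpar d ?_ ?_)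
  · rw [ha, map_smul] at h₁; exact (smul_eq_zero.1 h₁).resolve_left ha0
  · rw [hb, map_smul] at h₂; exact (smul_eq_zero.1 h₂).resolve_left hb0

lemma exists_separating {A B : Set Plane} (hA : Convex ℝ A) (hB : Convex ℝ B)
    (hAi : (interior A).Nonempty) (hBi : (interior B).Nonempty)
    (hd : Disjoint (interior A) (interior B)) :
    ∃ (g : StrongDual ℝ Plane) (c : ℝ), g ≠ 0 ∧ (∀ a ∈ A, g a ≤ c) ∧ ∀ b ∈ B, c ≤ g b := by
  obtain ⟨g, c, hg, h1, h2⟩ :=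
    geometric_hahn_banach_of_nonempty_interior hA hB.interior hd hAi hBi
  refine ⟨g, c, hg, h1, fun b hb => ?_⟩
  have : B ⊆ closure (interior B) := by
    rw [hB.closure_interior_eq_closure_of_nonempty_interior hBi]; exact subset_closure
  exact closure_minimal h2 (isClosed_le continuous_const g.continuous) (this hb)

/-- A common point of two non-overlapping convex sets cannot be moved inside both of them in two
independent directions. -/
lemma not_two_directions {A B : Set Plane} (hA : Convex ℝ A) (hB : Convex ℝ B)
    (hAi : (interior A).Nonempty) (hBi : (interior B).Nonempty)
    (hd : Disjoint (interior A) (interior B)) {f₁ f₂ : StrongDual ℝ Plane}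
    (hpar : ∀ x, f₁ x = 0 → f₂ x = 0 → x = 0) {e₁ e₂ v : Plane} (h₁ : f₁ e₁ = 0) (h₂ : f₂ e₂ = 0)
    (he₁ : e₁ ≠ 0) (he₂ : e₂ ≠ 0) (hvA : v ∈ A) (hvB : v ∈ B)
    (hs₁ : ∃ s : ℝ, s ≠ 0 ∧ v + s • e₁ ∈ A ∧ v + s • e₁ ∈ B)
    (hs₂ : ∃ s : ℝ, s ≠ 0 ∧ v + s • e₂ ∈ A ∧ v + s • e₂ ∈ B) : False := by
  obtain ⟨g, c, hg, hgA, hgB⟩ := exists_separating hA hB hAi hBi hd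
  have key : ∀ e : Plane, (∃ s : ℝ, s ≠ 0 ∧ v + s • e ∈ A ∧ v + s • e ∈ B) → g e = 0 := by
    rintro e ⟨s, hs, hsA, hsB⟩
    have h1 := hgA _ hvA
    have h2 := hgB _ hvB
    have h3 := hgA _ hsA
    have h4 := hgB _ hsB
    simp only [map_add, map_smul, smul_eq_mul] at h3 h4
    have : s * g e = 0 := by linarith
    exact (mul_eq_zero.1 this).resolve_left hs
  exact hg (eq_zero_of_apply_eq_zero hpar h₁ h₂ he₁ he₂ (key e₁ hs₁) (key e₂ hs₂))

/-- Among three convex sets containing `v`, each of which allows moving from `v` along `±e`, two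
allow a common move. -/
lemma exists_common_direction {A : Fin 3 → Set Plane} (hA : ∀ i, Convex ℝ (A i)) {v e : Plane}
    (hv : ∀ i, v ∈ A i) (h : ∀ i, ∃ s : ℝ, s ≠ 0 ∧ v + s • e ∈ A i) :
    ∃ m : Fin 3, ∃ s : ℝ, s ≠ 0 ∧ ∀ i ≠ m, v + s • e ∈ A i := by
  choose s hs hsA using h
  have hseg : ∀ i, ∀ t : ℝ, 0 ≤ t → t ≤ 1 → v + (t * s i) • e ∈ A i := fun i t h0 h1 => by
    have := (hA i) (hv i) (hsA i) (sub_nonneg.2 h1) h0 (by ring)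
    convert this using 1
    module
  have hpair : ∀ i j, 0 < s i * s j → ∃ t : ℝ, t ≠ 0 ∧ v + t • e ∈ A i ∧ v + t • e ∈ A j := by
    intro i j hij
    have key : ∀ i j, 0 < s i * s j → |s i| ≤ |s j| →
        ∃ t : ℝ, t ≠ 0 ∧ v + t • e ∈ A i ∧ v + t • e ∈ A j := by
      intro i j hij hle
      refine ⟨s i, hs i, hsA i, ?_⟩
      have hq : 0 ≤ s i / s j := by
        rw [← mul_div_mul_right _ _ (hs j)]; exact div_nonneg hij.le (mul_self_nonneg _)
      have hq1 : s i / s j ≤ 1 := by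
        rw [← abs_of_nonneg hq, abs_div]
        exact div_le_one_of_le₀ hle (abs_nonneg _)
      simpa [div_mul_cancel₀ _ (hs j)] using hseg j _ hq hq1
    rcases le_total |s i| |s j| with hle | hle
    · exact key i j hij hle
    · obtain ⟨t, h0, h1, h2⟩ := key j i (by linarith) hle
      exact ⟨t, h0, h2, h1⟩
  have hsign : 0 < s 1 * s 2 ∨ 0 < s 0 * s 2 ∨ 0 < s 0 * s 1 := by
    by_contra! hcon
    obtain ⟨h1, h2, h3⟩ := hcon
    have h1' : s 1 * s 2 < 0 := lt_of_le_of_ne h1 (mul_ne_zero (hs 1) (hs 2))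
    have h2' : s 0 * s 2 < 0 := lt_of_le_of_ne h2 (mul_ne_zero (hs 0) (hs 2))
    have h3' : s 0 * s 1 < 0 := lt_of_le_of_ne h3 (mul_ne_zero (hs 0) (hs 1))
    have := mul_pos_of_neg_of_neg h1' h2'
    nlinarith [sq_nonneg (s 2), mul_nonneg (sq_nonneg (s 2)) (neg_nonneg.2 h3'.le)]
  rcases hsign with h | h | h
  · obtain ⟨t, h0, h1, h2⟩ := hpair _ _ h
    exact ⟨0, t, h0, fun i hi => by fin_cases i <;> simp_all⟩
  · obtain ⟨t, h0, h1, h2⟩ := hpair _ _ h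
    exact ⟨1, t, h0, fun i hi => by fin_cases i <;> simp_all⟩
  · obtain ⟨t, h0, h1, h2⟩ := hpair _ _ h
    exact ⟨2, t, h0, fun i hi => by fin_cases i <;> simp_all⟩

/-- Three pairwise non-overlapping convex sets with four independent pairs of opposite edges have no
common point. -/
lemma not_three_disjoint {A : Fin 3 → Set Plane} (hA : ∀ i, Convex ℝ (A i))
    (hAi : ∀ i, (interior (A i)).Nonempty)
    (hd : ∀ i j, i ≠ j → Disjoint (interior (A i)) (interior (A j)))
    {f : Fin 4 → StrongDual ℝ Plane} (hpar : ∀ k l, k ≠ l → ∀ x, f k x = 0 → f l x = 0 → x = 0)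
    {e : Fin 4 → Plane} (hedge : ∀ k i, HasEdgePair (A i) (f k) (e k)) {v : Plane}
    (hv : ∀ i, v ∈ A i) : False := by
  choose m s hs hsm using fun k =>
    exists_common_direction hA hv fun i => (hedge k i).exists_add_smul_mem (hA i) (hv i)
  obtain ⟨k, l, hkl, hm⟩ := Fintype.exists_ne_map_eq_of_card_lt m (by simp)
  obtain ⟨i, j, hij, hi, hj⟩ : ∃ i j : Fin 3, i ≠ j ∧ i ≠ m k ∧ j ≠ m k := by
    generalize m k = a
    revert a; decide
  exact not_two_directions (hA i) (hA j) (hAi i) (hAi j) (hd i j hij) (hpar k l hkl)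
    (hedge k i).2.1 (hedge l i).2.1 (hedge k i).1 (hedge l i).1 (hv i) (hv j)
    ⟨s k, hs k, hsm k i hi, hsm k j hj⟩
    ⟨s l, hs l, hsm l i (hm ▸ hi), hsm l j (hm ▸ hj)⟩

lemma exists_eq_smul_of_apply_eq_zero {g : StrongDual ℝ Plane} (hg : g ≠ 0) {e : Plane}
    (he0 : e ≠ 0) (he : g e = 0) : ∀ v, g v = 0 → ∃ s : ℝ, v = s • e := by
  obtain ⟨u, hu⟩ := exists_apply_ne_zero hg
  obtain ⟨d, hd0, -, hk⟩ := exists_ker_span g hu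
  intro v hv
  obtain ⟨a, ha⟩ := hk e he
  obtain ⟨b, hb⟩ := hk v hv
  have ha0 : a ≠ 0 := fun h => he0 (by simp [ha, h])
  exact ⟨b / a, by rw [ha, smul_smul, div_mul_cancel₀ _ ha0, hb]⟩

lemma notMem_extremePoints_of_add_sub {A : Set Plane} {v d : Plane} (hd : d ≠ 0)
    (h1 : v + d ∈ A) (h2 : v - d ∈ A) : v ∉ A.extremePoints ℝ := by
  intro hv
  have := (mem_extremePoints_iff_left.1 hv).2 _ h1 _ h2
    ⟨1 / 2, 1 / 2, by norm_num, by norm_num, by norm_num, by module⟩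
  exact hd (by simpa using this)

lemma exists_pos_dist_add_smul_lt (v d : Plane) {ε : ℝ} (hε : 0 < ε) :
    ∃ t : ℝ, 0 < t ∧ ∀ s : ℝ, |s| ≤ t → dist (v + s • d) v < ε := by
  refine ⟨ε / (‖d‖ + 1), by positivity, fun s hs => ?_⟩
  rw [dist_self_add_left, norm_smul, Real.norm_eq_abs]
  calc |s| * ‖d‖ ≤ ε / (‖d‖ + 1) * ‖d‖ := by gcongr
    _ < ε / (‖d‖ + 1) * (‖d‖ + 1) := by gcongr; linarith
    _ = ε := by field_simp

/-- A closed set containing a small half-disc has no extreme point at its centre. -/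
lemma notMem_extremePoints_of_half_ball {A : Set Plane} (hA : IsClosed A) {v : Plane}
    {g : StrongDual ℝ Plane} (hg : g ≠ 0) {ε : ℝ} (hε : 0 < ε)
    (hball : ∀ y, dist y v < ε → g y < g v → y ∈ A) : v ∉ A.extremePoints ℝ := by
  obtain ⟨u, hu⟩ := exists_apply_ne_zero hg
  obtain ⟨d, hd0, hgd, -⟩ := exists_ker_span g hu
  obtain ⟨t, ht, hs⟩ := exists_pos_dist_add_smul_lt v d hε
  have key : ∀ s : ℝ, |s| ≤ t → v + s • d ∈ A := by
    intro s hst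
    have hlim : Filter.Tendsto (fun δ : ℝ => v + s • d - (δ * g u) • u) (nhdsWithin 0 (Ioi 0))
        (nhds (v + s • d)) := by
      have : Filter.Tendsto (fun δ : ℝ => v + s • d - (δ * g u) • u) (nhds 0)
          (nhds (v + s • d - ((0 : ℝ) * g u) • u)) := Continuous.tendsto (by fun_prop) 0
      simp only [zero_mul, zero_smul, sub_zero] at this
      exact this.mono_left nhdsWithin_le_nhds
    refine hA.mem_of_tendsto hlim ?_
    filter_upwards [hlim.eventually (Metric.isOpen_ball.mem_nhds (Metric.mem_ball.2 (hs s hst))),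
      self_mem_nhdsWithin] with δ h1 h2
    refine hball _ (Metric.mem_ball.1 h1) ?_
    simp only [map_sub, map_add, map_smul, smul_eq_mul, hgd]
    have hpos : 0 < δ * (g u * g u) := mul_pos h2 (mul_self_pos.2 hu)
    linarith
  refine notMem_extremePoints_of_add_sub (smul_ne_zero ht.ne' hd0)
    (key t (by rw [abs_of_pos ht])) ?_
  have := key (-t) (by rw [abs_neg, abs_of_pos ht])
  rwa [neg_smul, ← sub_eq_add_neg] at this

lemma notMem_interior_of_mem_extremePoints {A : Set Plane} {v : Plane}
    (hv : v ∈ A.extremePoints ℝ) : v ∉ interior A := by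
  intro hi
  obtain ⟨ε, hε, hb⟩ := Metric.isOpen_iff.1 isOpen_interior v hi
  obtain ⟨d, hd⟩ := exists_ne (0 : Plane)
  obtain ⟨t, ht, hs⟩ := exists_pos_dist_add_smul_lt v d hε
  refine notMem_extremePoints_of_add_sub (smul_ne_zero ht.ne' hd)
    (interior_subset (hb (hs t (by rw [abs_of_pos ht]))))
    (interior_subset (hb ?_)) hv
  have := hs (-t) (by rw [abs_neg, abs_of_pos ht])
  rwa [neg_smul, ← sub_eq_add_neg] at this

namespace IsDoubleCover

variable {ι : Type} {T : ι → Set Plane}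

/-- Two non-overlapping members do not fill a neighbourhood of an extreme point of one of them. -/
lemma exists_near_notMem (hT : IsDoubleCover T) {i j : ι} {v : Plane}
    (hv : v ∈ (T i).extremePoints ℝ) (hd : Disjoint (interior (T i)) (interior (T j)))
    {ε : ℝ} (hε : 0 < ε) :
    ∃ y, dist y v < ε ∧ y ∉ T i ∧ y ∉ T j := by
  by_contra! hcon
  obtain ⟨g, c, hg, hgi, hgj⟩ := exists_separating (hT.convex i) (hT.convex j)
    (hT.interior_nonempty i) (hT.interior_nonempty j) hd
  refine notMem_extremePoints_of_half_ball (hT.isClosed i) hg hε (fun y hy hgy => ?_) hv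
  by_contra hni
  exact absurd (hgj y (hcon y hy hni)) (not_le.2 (hgy.trans_le (hgi v hv.1)))

/-- Two further members through an interior point of a member do not overlap. -/
lemma disjoint_of_mem_interior (hT : IsDoubleCover T) {i j k : ι} {v : Plane}
    (hvk : v ∈ interior (T k)) (hvi : v ∈ T i) (hvj : v ∈ T j) (hik : i ≠ k) (hjk : j ≠ k)
    (hij : i ≠ j) : Disjoint (interior (T i)) (interior (T j)) := by
  rw [Set.disjoint_left]
  intro z hzi hzj
  have hcont : Filter.Tendsto (fun t : ℝ => v + t • (z - v)) (nhdsWithin 0 (Ioi 0))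
      (nhds v) := by
    have : Filter.Tendsto (fun t : ℝ => v + t • (z - v)) (nhds 0)
        (nhds (v + (0 : ℝ) • (z - v))) := Continuous.tendsto (by fun_prop) 0
    simp only [zero_smul, add_zero] at this
    exact this.mono_left nhdsWithin_le_nhds
  obtain ⟨t, ⟨hk, ht1⟩, ht0⟩ := (((hcont.eventually (isOpen_interior.mem_nhds hvk)).and
    (nhdsWithin_le_nhds (Iio_mem_nhds one_pos))).and self_mem_nhdsWithin).exists
  have ht : t ∈ Ioc (0 : ℝ) 1 := ⟨ht0, (mem_Iio.1 ht1).le⟩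
  exact hT.not_triple _ i j k hij hik hjk
    ((hT.convex i).add_smul_sub_mem_interior hvi hzi ht)
    ((hT.convex j).add_smul_sub_mem_interior hvj hzj ht) hk

/-- With four independent pairs of edges, three members through a point overlap. -/
lemma not_three_disjoint (hT : IsDoubleCover T) {f : Fin 4 → StrongDual ℝ Plane}
    (hpar : ∀ k l, k ≠ l → ∀ x, f k x = 0 → f l x = 0 → x = 0)
    {e : Fin 4 → Plane} (hedge : ∀ k i, HasEdgePair (T i) (f k) (e k)) {v : Plane} {i j l : ι}
    (hi : v ∈ T i) (hj : v ∈ T j) (hl : v ∈ T l)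
    (hij : Disjoint (interior (T i)) (interior (T j)))
    (hil : Disjoint (interior (T i)) (interior (T l)))
    (hjl : Disjoint (interior (T j)) (interior (T l))) : False := by
  refine _root_.not_three_disjoint (A := fun a => T (![i, j, l] a)) (fun a => hT.convex _)
    (fun a => hT.interior_nonempty _) ?_ hpar (fun k a => hedge k _) (v := v) ?_
  · intro a b hab
    fin_cases a <;> fin_cases b <;> simp_all [disjoint_comm]
  · intro a
    fin_cases a <;> simp_all

lemma extremePoint_notMem_interior (hT : IsDoubleCover T) {f : Fin 4 → StrongDual ℝ Plane}
    (hpar : ∀ k l, k ≠ l → ∀ x, f k x = 0 → f l x = 0 → x = 0)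
    {e : Fin 4 → Plane} (hedge : ∀ k i, HasEdgePair (T i) (f k) (e k)) {v : Plane} {i k : ι}
    (hv : v ∈ (T i).extremePoints ℝ) : v ∉ interior (T k) := by
  intro hvk
  have hvi := notMem_interior_of_mem_extremePoints hv
  have hik : i ≠ k := by rintro rfl; exact hvi hvk
  obtain ⟨j, hvj, hd⟩ := hT.exists_disjoint_neighbour hv.1 hvi
  have hjk : j ≠ k := by
    rintro rfl
    obtain ⟨z, hz1, hz2⟩ := mem_closure_iff.1 (hT.subset_closure_interior i hv.1) _
      isOpen_interior hvk
    exact Set.disjoint_left.1 hd hz2 hz1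
  obtain ⟨ε₁, hε₁, hb₁⟩ := Metric.isOpen_iff.1 isOpen_interior v hvk
  obtain ⟨ε₂, hε₂, hb₂⟩ := exists_ball_meet_imp_mem hT.isClosed hT.finite_meet v
  obtain ⟨y, hy, hyi, hyj⟩ := hT.exists_near_notMem hv hd (lt_min hε₁ hε₂)
  obtain ⟨l, hlk, hyl⟩ : ∃ l, l ≠ k ∧ y ∈ T l := by
    obtain ⟨a, b, hab, ha, hb⟩ := hT.exists_pair y
    rcases eq_or_ne a k with rfl | h
    · exact ⟨b, hab.symm, hb⟩
    · exact ⟨a, h, ha⟩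
  have hvl := hb₂ l y hyl (hy.trans_le (min_le_right _ _))
  have hil : i ≠ l := by rintro rfl; exact hyi hyl
  have hjl : j ≠ l := by rintro rfl; exact hyj hyl
  exact hT.not_three_disjoint hpar hedge hv.1 hvj hvl hd
    (hT.disjoint_of_mem_interior hvk hv.1 hvl hik hlk hil)
    (hT.disjoint_of_mem_interior hvk hvj hvl hjk hlk hjl)

end IsDoubleCover

/-- A convex set whose edges parallel to `e` are as long as an interior chord is a parallelogram. -/
lemma HasEdgePair.exists_parallelogram {B : Set Plane} (hB : Convex ℝ B)
    {f : StrongDual ℝ Plane} {e : Plane} (h : HasEdgePair B f e) (hf : f ≠ 0) {v : Plane} {s : ℝ}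
    (hs0 : 0 ≤ s) (hs1 : s ≤ 1) (hx : v + s • e ∈ interior B) (hv : v ∉ interior B)
    (hve : v + e ∉ interior B) :
    ∃ r d : Plane, f d ≠ 0 ∧ r ∈ B ∧ r + e ∈ B ∧ r + d ∈ B ∧ r + e + d ∈ B ∧
      ∀ b ∈ B, ∃ α β : ℝ, 0 ≤ α ∧ α ≤ 1 ∧ 0 ≤ β ∧ β ≤ 1 ∧ b = r + α • e + β • d := by
  have hk := exists_eq_smul_of_apply_eq_zero hf h.1 h.2.1
  have he := h.2.1
  obtain ⟨q, r, hq, hqe, hr, hre, hmax, hmin⟩ := h.exists_faces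
  have hs : ∀ w, w ∈ B → w + e ∈ B → f w = f v → w = v := by
    intro w hw hwe hfw
    obtain ⟨a, ha⟩ := hk (w - v) (by simp [hfw])
    rcases lt_trichotomy a 0 with h | rfl | h
    · exfalso
      have hD : 0 < s - a := by linarith
      have := hB.combo_self_interior_mem_interior hw hx (a := s / (s - a)) (b := -a / (s - a))
        (by positivity) (div_pos (by linarith) hD) (by field_simp; ring)
      apply hv
      convert this using 1
      have h1 : s / (s - a) + -a / (s - a) = 1 := by field_simp; ring
      have h2 : s / (s - a) * a + -a / (s - a) * s = 0 := by ring
      have hw' : w = v + a • e := by rw [← ha]; abel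
      rw [hw']
      calc v = (1 : ℝ) • v + (0 : ℝ) • e := by simp
        _ = _ := by rw [← h1, ← h2]; module
    · simpa [sub_eq_zero] using ha
    · exfalso
      have hD : 0 < a + 1 - s := by linarith
      have := hB.combo_self_interior_mem_interior hwe hx (a := (1 - s) / (a + 1 - s))
        (b := a / (a + 1 - s)) (div_nonneg (by linarith) hD.le) (by positivity)
        (by field_simp; ring)
      apply hve
      convert this using 1
      have h1 : (1 - s) / (a + 1 - s) + a / (a + 1 - s) = 1 := by field_simp; ring
      have h2 : (1 - s) / (a + 1 - s) * (a + 1) + a / (a + 1 - s) * s = 1 := by field_simp; ring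
      have hw' : w = v + a • e := by rw [← ha]; abel
      rw [hw']
      calc v + e = (1 : ℝ) • v + (1 : ℝ) • e := by simp
        _ = ((1 - s) / (a + 1 - s) + a / (a + 1 - s)) • v
            + ((1 - s) / (a + 1 - s) * (a + 1) + a / (a + 1 - s) * s) • e := by rw [h1, h2]
        _ = _ := by module
  obtain ⟨u, hu⟩ : ∃ u, 0 < f u := by
    by_contra! hcon
    exact hf (ContinuousLinearMap.ext fun z => le_antisymm (hcon z) (by simpa using hcon (-z)))
  obtain ⟨ε, hε, hb⟩ := Metric.isOpen_iff.1 isOpen_interior _ hx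
  obtain ⟨t, ht, htb⟩ := exists_pos_dist_add_smul_lt (v + s • e) u hε
  have hlt1 : f v < f q := by
    have := hmax _ (interior_subset (hb (htb t (by rw [abs_of_pos ht]))))
    simp only [map_add, map_smul, he, smul_eq_mul] at this
    nlinarith
  have hlt2 : f r < f v := by
    have := hmin _ (interior_subset (hb (htb (-t) (by rw [abs_neg, abs_of_pos ht]))))
    simp only [map_add, map_smul, he, smul_eq_mul] at this
    nlinarith
  have hD : 0 < f q - f r := by linarith
  set l := (f v - f r) / (f q - f r) with hl
  have hl0 : 0 < l := div_pos (by linarith) hD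
  have hl1 : 0 < 1 - l := by
    rw [hl, sub_pos, div_lt_one hD]; linarith
  have hvl : (1 - l) • r + l • q = v := by
    refine hs _ (hB hr hq hl1.le hl0.le (by ring)) ?_ ?_
    · have := hB hre hqe hl1.le hl0.le (by ring)
      convert this using 1
      module
    · simp only [map_add, map_smul, smul_eq_mul]
      rw [hl]; field_simp; ring
  obtain ⟨g, hg⟩ := geometric_hahn_banach_open_point hB.interior isOpen_interior hv
  obtain ⟨g', hg'⟩ := geometric_hahn_banach_open_point hB.interior isOpen_interior hve
  have hcl : ∀ y ∈ B, y ∈ closure (interior B) := fun y hy => by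
    rw [hB.closure_interior_eq_closure_of_nonempty_interior ⟨_, hx⟩]; exact subset_closure hy
  have hgB : ∀ y ∈ B, g y ≤ g v := fun y hy =>
    closure_minimal (fun z hz => (hg z hz).le) (isClosed_le g.continuous continuous_const)
      (hcl y hy)
  have hgB' : ∀ y ∈ B, g' y ≤ g' (v + e) := fun y hy =>
    closure_minimal (fun z hz => (hg' z hz).le) (isClosed_le g'.continuous continuous_const)
      (hcl y hy)
  have hge : g e < 0 := by
    have := hg _ hx
    simp only [map_add, map_smul, smul_eq_mul] at this
    by_contra! hc
    nlinarith [mul_nonneg hs0 hc]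
  have hge' : 0 < g' e := by
    have := hg' _ hx
    simp only [map_add, map_smul, smul_eq_mul] at this
    by_contra! hc
    nlinarith [mul_nonneg (sub_nonneg.2 hs1) (neg_nonneg.2 hc)]
  have hflat : ∀ g : StrongDual ℝ Plane, g r ≤ g v → g q ≤ g v → g r = g v ∧ g q = g v := by
    intro g h1 h2
    have h3 : (1 - l) * g r + l * g q = g v := by rw [← hvl]; simp
    constructor
    · nlinarith
    · nlinarith
  obtain ⟨h1, h2⟩ := hflat g (hgB r hr) (hgB q hq)
  obtain ⟨h3, h4⟩ := hflat g' (by simpa using hgB' _ hre) (by simpa using hgB' _ hqe)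
  refine ⟨r, q - r, by simpa using hD.ne', hr, hre, by simpa using hq, ?_, fun b hb => ?_⟩
  · convert hqe using 1; abel
  · obtain ⟨α, hα⟩ := hk (b - r - ((f b - f r) / (f q - f r)) • (q - r)) (by
      simp only [map_sub, map_smul, smul_eq_mul]; field_simp; ring)
    have hb' : b = r + α • e + ((f b - f r) / (f q - f r)) • (q - r) := by rw [← hα]; abel
    have h5 := hgB b hb
    have h6 := hgB' b hb
    rw [hb'] at h5 h6
    simp only [map_add, map_sub, map_smul, smul_eq_mul, h1, h2, h3, h4, sub_self, mul_zero,
      add_zero] at h5 h6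
    refine ⟨α, (f b - f r) / (f q - f r), by nlinarith, by nlinarith,
      div_nonneg (by linarith [hmin b hb]) hD.le, ?_, hb'⟩
    rw [div_le_one hD]; linarith [hmax b hb]

lemma coeff_eq_of_isMax {x y α β α' β' : ℝ} (hx : x ≠ 0) (ha0 : 0 ≤ α) (ha1 : α ≤ 1)
    (hb0 : 0 ≤ β) (hb1 : β ≤ 1) (ha0' : 0 ≤ α') (ha1' : α' ≤ 1)
    (heq : α * x + β * y = α' * x + β' * y) (hb0' : 0 ≤ β') (hb1' : β' ≤ 1)
    (h00 : 0 ≤ α * x + β * y) (h10 : x ≤ α * x + β * y)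
    (h01 : y ≤ α * x + β * y) (h11 : x + y ≤ α * x + β * y) : α = α' := by
  have key : ∀ b : ℝ, 0 ≤ b → b ≤ 1 → b * y ≤ 0 ∨ b * y ≤ y := fun b h0 h1 => by
    rcases le_total 0 y with h | h
    · exact Or.inr (mul_le_of_le_one_left h h1)
    · exact Or.inl (mul_nonpos_of_nonneg_of_nonpos h0 h)
  rcases lt_or_gt_of_ne hx with h | h
  · have h1 : 0 ≤ α * x := by rcases key β hb0 hb1 with h | h <;> linarith
    have h2 : 0 ≤ α' * x := by rcases key β' hb0' hb1' with h | h <;> linarith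
    rw [le_antisymm (nonpos_of_mul_nonneg_left h1 h) ha0,
      le_antisymm (nonpos_of_mul_nonneg_left h2 h) ha0']
  · have h1 : 1 * x ≤ α * x := by rcases key β hb0 hb1 with h | h <;> linarith
    have h2 : 1 * x ≤ α' * x := by rcases key β' hb0' hb1' with h | h <;> linarith
    rw [le_antisymm ha1 (le_of_mul_le_mul_right h1 h),
      le_antisymm ha1' (le_of_mul_le_mul_right h2 h)]

lemma parallelogram_edge {B : Set Plane} {r e d : Plane} (h00 : r ∈ B) (h10 : r + e ∈ B)
    (h01 : r + d ∈ B) (h11 : r + e + d ∈ B)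
    (hB : ∀ b ∈ B, ∃ α β : ℝ, 0 ≤ α ∧ α ≤ 1 ∧ 0 ≤ β ∧ β ≤ 1 ∧ b = r + α • e + β • d)
    {h : StrongDual ℝ Plane} {e' : Plane} (hedge : HasEdgePair B h e') : h e = 0 ∨ h d = 0 := by
  by_contra! hcon
  obtain ⟨hne, hnd⟩ := hcon
  obtain ⟨q, -, hq, hqe, -, -, hmax, -⟩ := hedge.exists_faces
  obtain ⟨α, β, ha0, ha1, hb0, hb1, hqq⟩ := hB q hq
  obtain ⟨α', β', ha0', ha1', hb0', hb1', hqq'⟩ := hB _ hqe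
  have e1 : h q = h r + α * h e + β * h d := by rw [hqq]; simp
  have e2 : h q = h r + α' * h e + β' * h d := by
    have : h (q + e') = h q := by simp [hedge.2.1]
    rw [← this, hqq']; simp
  have c00 := hmax _ h00
  have c10 := hmax _ h10
  have c01 := hmax _ h01
  have c11 := hmax _ h11
  simp only [map_add] at c10 c01 c11
  have key : α = α' ∧ β = β' := by
    constructor
    · refine coeff_eq_of_isMax (y := h d) hne ha0 ha1 hb0 hb1 ha0' ha1' ?_ hb0' hb1' ?_ ?_ ?_ ?_
        <;> linarith
    · refine coeff_eq_of_isMax (y := h e) hnd hb0 hb1 ha0 ha1 hb0' hb1' ?_ ha0' ha1' ?_ ?_ ?_ ?_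
        <;> linarith
  apply hedge.1
  rw [key.1, key.2, ← hqq'] at hqq
  simpa using hqq.symm

namespace IsDoubleCover

variable {ι : Type} {T : ι → Set Plane}

lemma disjoint_interior_boundary (hT : IsDoubleCover T)
    (hall : ∀ g : StrongDual ℝ Plane, g ≠ 0 → ∀ i, (g.toExposed (T i)).Nontrivial →
      ∃ e, ∀ j, HasEdgePair (T j) g e)
    {f : Fin 4 → StrongDual ℝ Plane}
    (hpar : ∀ k l, k ≠ l → ∀ x, f k x = 0 → f l x = 0 → x = 0)
    {e : Fin 4 → Plane} (hedge : ∀ k i, HasEdgePair (T i) (f k) (e k)) {q : Plane} {i k : ι}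
    (hqi : q ∈ T i) (hqi' : q ∉ interior (T i)) : q ∉ interior (T k) := by
  intro hqk
  obtain ⟨g, hg⟩ := geometric_hahn_banach_open_point (hT.convex i).interior isOpen_interior hqi'
  have hg0 : g ≠ 0 := by
    rintro rfl
    obtain ⟨a, ha⟩ := hT.interior_nonempty i
    simpa using hg a ha
  have hle : ∀ y ∈ T i, g y ≤ g q := fun y hy =>
    closure_minimal (fun z hz => (hg z hz).le) (isClosed_le g.continuous continuous_const)
      (hT.subset_closure_interior i hy)
  have hqg : q ∈ g.toExposed (T i) := ⟨hqi, hle⟩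
  have hext := (toExposed_isExtreme g (T i)).extremePoints_subset_extremePoints
  by_cases hnt : (g.toExposed (T i)).Nontrivial
  · obtain ⟨d, hd⟩ := hall g hg0 i hnt
    obtain ⟨hd0, hgd, v, -, hv, -⟩ := hd i
    rw [hv] at hqg hext
    obtain ⟨s, hs0, hs1, rfl⟩ := mem_segment_add.1 hqg
    have h1 := hT.extremePoint_notMem_interior hpar hedge (k := k)
      (hext (left_mem_extremePoints_segment hd0))
    have h2 := hT.extremePoint_notMem_interior hpar hedge (k := k)
      (hext (right_mem_extremePoints_segment hd0))
    obtain ⟨r, c, hc, h00, h10, h01, h11, hB⟩ :=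
      (hd k).exists_parallelogram (hT.convex k) hg0 hs0 hs1 hqk h1 h2
    have hor : ∀ a, f a d = 0 ∨ f a c = 0 := fun a =>
      parallelogram_edge h00 h10 h01 h11 hB (hedge a k)
    have hc0 : c ≠ 0 := by rintro rfl; simp at hc
    classical
    obtain ⟨a, b, hab, heq⟩ := Fintype.exists_ne_map_eq_of_card_lt
      (fun a => decide (f a d = 0)) (by simp)
    simp only [decide_eq_decide] at heq
    rcases hor a with h | h
    · exact hd0 (hpar a b hab d h (heq.1 h))
    · rcases hor b with h' | h'
      · exact hd0 (hpar a b hab d (heq.2 h') h')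
      · exact hc0 (hpar a b hab c h h')
  · have hs : g.toExposed (T i) = {q} :=
      (Set.not_nontrivial_iff.1 hnt).eq_singleton_of_mem hqg
    rw [hs] at hext
    exact hT.extremePoint_notMem_interior hpar hedge (hext (by simp)) hqk

lemma subset_of_not_disjoint (hT : IsDoubleCover T)
    (hbd : ∀ i k q, q ∈ T i → q ∉ interior (T i) → q ∉ interior (T k)) {i k : ι}
    (h : ¬ Disjoint (interior (T k)) (interior (T i))) : T k ⊆ T i := by
  have h1 : interior (T k) ⊆ interior (T i) := by
    refine (hT.convex k).interior.isPreconnected.subset_left_of_subset_union isOpen_interior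
      (hT.isClosed i).isOpen_compl (Set.disjoint_left.2 fun x hx hx' => hx' (interior_subset hx))
      (fun x hx => ?_) (not_disjoint_iff_nonempty_inter.1 h)
    by_cases hxi : x ∈ T i
    · left
      by_contra hc
      exact hbd i k x hxi hc hx
    · exact Or.inr hxi
  exact (hT.subset_closure_interior k).trans
    (closure_minimal (h1.trans interior_subset) (hT.isClosed i))

/-- The members of a double cover have at most three pairs of parallel edges, provided that all
members have equal pairs of edges in the same directions. -/
theorem not_four_directions [Nonempty ι] (hT : IsDoubleCover T) (hcomp : ∀ i, IsCompact (T i))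
    (hall : ∀ g : StrongDual ℝ Plane, g ≠ 0 → ∀ i, (g.toExposed (T i)).Nontrivial →
      ∃ e, ∀ j, HasEdgePair (T j) g e)
    {f : Fin 4 → StrongDual ℝ Plane}
    (hpar : ∀ k l, k ≠ l → ∀ x, f k x = 0 → f l x = 0 → x = 0)
    {e : Fin 4 → Plane} (hedge : ∀ k i, HasEdgePair (T i) (f k) (e k)) : False := by
  have hsub : ∀ {i k : ι}, ¬ Disjoint (interior (T k)) (interior (T i)) → T k ⊆ T i :=
    hT.subset_of_not_disjoint fun i k q => hT.disjoint_interior_boundary hall hpar hedge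
  obtain ⟨i⟩ := ‹Nonempty ι›
  obtain ⟨v, hv⟩ := (hcomp i).extremePoints_nonempty
    ((hT.interior_nonempty i).mono interior_subset)
  obtain ⟨j, hvj, hd⟩ := hT.exists_disjoint_neighbour hv.1
    (notMem_interior_of_mem_extremePoints hv)
  obtain ⟨ε, hε, hb⟩ := exists_ball_meet_imp_mem hT.isClosed hT.finite_meet v
  obtain ⟨y, hy, hyi, hyj⟩ := hT.exists_near_notMem hv hd hε
  obtain ⟨k, -, -, hyk, -⟩ := hT.exists_pair y
  refine hT.not_three_disjoint hpar hedge hv.1 hvj (hb k y hyk hy) hd ?_ ?_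
  · by_contra hc
    exact hyi (hsub (fun h => hc h.symm) hyk)
  · by_contra hc
    exact hyj (hsub (fun h => hc h.symm) hyk)

end IsDoubleCover

open scoped ENNReal NNReal

/-- Integrable weights on the plane that vary slowly at a given scale. -/
lemma exists_slowly_varying_weight {R : ℝ} (hR : 0 ≤ R) {κ : ℝ≥0} (hκ : 1 < κ) :
    ∃ g : Plane → ℝ≥0∞, Measurable g ∧ (∀ p, g p ≠ 0) ∧ ∫⁻ p, g p ≠ ∞ ∧
      ∀ p q, dist p q ≤ R → g p ≤ κ * g q := by
  obtain ⟨M, hM, hM1⟩ : ∃ M : ℝ, (1 + R / M) ^ 3 < κ ∧ 1 ≤ M := by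
    have hlim : Filter.Tendsto (fun M : ℝ => (1 + R / M) ^ 3) Filter.atTop
        (nhds ((1 + 0) ^ 3)) :=
      ((Filter.Tendsto.const_div_atTop Filter.tendsto_id R).const_add 1).pow 3
    exact ((hlim.eventually (Iio_mem_nhds (by simpa using hκ))).and
      (Filter.eventually_ge_atTop 1)).exists
  have hpos : ∀ p : Plane, 0 < M + ‖p‖ := fun p => by positivity
  refine ⟨fun p => ENNReal.ofReal ((M + ‖p‖) ^ (-3 : ℝ)), by fun_prop, fun p => ?_, ?_, ?_⟩
  · have : 0 < (M + ‖p‖) ^ (-3 : ℝ) := Real.rpow_pos_of_pos (hpos p) _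
    simpa using this
  · have hint : Integrable (fun p : Plane => (1 + ‖p‖) ^ (-3 : ℝ)) :=
      integrable_one_add_norm (by simp; norm_num)
    refine ((lintegral_mono fun p => ?_).trans_lt hint.lintegral_lt_top).ne
    exact ENNReal.ofReal_le_ofReal (Real.rpow_le_rpow_of_nonpos (by positivity) (by gcongr)
      (by norm_num))
  · intro p q hpq
    rw [← ENNReal.ofReal_coe_nnreal, ← ENNReal.ofReal_mul (by positivity)]
    refine ENNReal.ofReal_le_ofReal ?_
    have h1 : M + ‖q‖ ≤ (1 + R / M) * (M + ‖p‖) := by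
      have h2 : ‖q‖ ≤ ‖p‖ + R := by
        have := norm_le_norm_add_norm_sub' q p
        rw [← dist_eq_norm, dist_comm] at this
        linarith
      have h3 : (1 + R / M) * (M + ‖p‖) = M + ‖p‖ + R + R / M * ‖p‖ := by field_simp; ring
      have : 0 ≤ R / M * ‖p‖ := by positivity
      linarith
    have h3 : ∀ x : ℝ, 0 < x → x ^ (-3 : ℝ) = (x ^ 3)⁻¹ := fun x hx => by
      rw [Real.rpow_neg hx.le]; norm_cast
    rw [h3 _ (hpos p), h3 _ (hpos q), ← div_eq_mul_inv, inv_eq_one_div,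
      div_le_div_iff₀ (pow_pos (hpos p) 3) (pow_pos (hpos q) 3), one_mul]
    calc (M + ‖q‖) ^ 3 ≤ ((1 + R / M) * (M + ‖p‖)) ^ 3 := pow_le_pow_left₀ (hpos q).le h1 3
      _ = (1 + R / M) ^ 3 * (M + ‖p‖) ^ 3 := by ring
      _ ≤ κ * (M + ‖p‖) ^ 3 := by gcongr

lemma add_smul_mem_of_abs_le {A : Set Plane} (hA : Convex ℝ A) {p e : Plane} {δ : ℝ} (hδ : 0 < δ)
    (h1 : p + δ • e ∈ A) (h2 : p - δ • e ∈ A) {a : ℝ} (ha : |a| ≤ δ) : p + a • e ∈ A := by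
  obtain ⟨h3, h4⟩ := abs_le.1 ha
  have := hA h1 h2 (a := (δ + a) / (2 * δ)) (b := (δ - a) / (2 * δ))
    (div_nonneg (by linarith) (by linarith)) (div_nonneg (by linarith) (by linarith))
    (by field_simp; ring)
  convert this using 1
  have h5 : (δ + a) / (2 * δ) + (δ - a) / (2 * δ) = 1 := by field_simp; ring
  have h6 : (δ + a) / (2 * δ) * δ - (δ - a) / (2 * δ) * δ = a := by field_simp; ring
  calc p + a • e = ((δ + a) / (2 * δ) + (δ - a) / (2 * δ)) • p
        + ((δ + a) / (2 * δ) * δ - (δ - a) / (2 * δ) * δ) • e := by rw [h5, h6, one_smul]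
    _ = _ := by module

lemma eventually_add_smul_mem_interior {A : Set Plane} (hA : Convex ℝ A)
    (hAi : (interior A).Nonempty) {f : StrongDual ℝ Plane} {u e p y : Plane} (hu : 0 < f u)
    (hk : ∀ v, f v = 0 → ∃ s : ℝ, v = s • e) {δ : ℝ} (hδ : 0 < δ)
    (h1 : p + δ • e ∈ A) (h2 : p - δ • e ∈ A) (hy : y ∈ A) (hfy : f p < f y) :
    ∀ᶠ t : ℝ in nhdsWithin 0 (Ioi 0), p + t • u ∈ interior A := by
  have hy' : y ∈ closure (interior A) := by
    rw [hA.closure_interior_eq_closure_of_nonempty_interior hAi]; exact subset_closure hy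
  obtain ⟨z, hfz, hz⟩ := mem_closure_iff.1 hy' _ (isOpen_lt continuous_const f.continuous) hfy
  replace hfz : f p < f z := hfz
  set β := (f z - f p) / f u with hβ
  have hβ0 : 0 < β := div_pos (by linarith) hu
  obtain ⟨γ, hγ⟩ := hk (z - p - β • u) (by
    simp only [map_sub, map_smul, smul_eq_mul]; rw [hβ]; field_simp; ring)
  have hlim : Filter.Tendsto (fun t : ℝ => -(t / β / (1 - t / β) * γ)) (nhdsWithin 0 (Ioi 0))
      (nhds 0) := by
    have : ContinuousAt (fun t : ℝ => -(t / β / (1 - t / β) * γ)) 0 := by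
      refine ((ContinuousAt.div (by fun_prop) (by fun_prop) (by simp)).mul
        continuousAt_const).neg
    have h0 := this.tendsto
    simp only [zero_div, zero_mul, neg_zero] at h0
    exact h0.mono_left nhdsWithin_le_nhds
  filter_upwards [hlim.eventually (Metric.ball_mem_nhds 0 hδ),
    nhdsWithin_le_nhds (Iio_mem_nhds hβ0), self_mem_nhdsWithin] with t ht1 ht2 ht3
  have hw := add_smul_mem_of_abs_le hA hδ h1 h2 (a := -(t / β / (1 - t / β) * γ))
    (by simpa only [Real.norm_eq_abs] using (mem_ball_zero_iff.1 ht1).le)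
  have hlt : t / β < 1 := (div_lt_one hβ0).2 ht2
  have hpos : 0 < 1 - t / β := by linarith
  have := hA.combo_self_interior_mem_interior hw hz hpos.le (div_pos ht3 hβ0) (by ring)
  convert this using 1
  have hz' : z = p + β • u + γ • e := by rw [← hγ]; abel
  have h3 : (1 - t / β) * (t / β / (1 - t / β)) = t / β := by
    rw [mul_comm, div_mul_cancel₀ _ hpos.ne']
  have h4 : t / β * β = t := by field_simp
  rw [hz']
  calc p + t • u = p + (t / β * β) • u + ((t / β) * γ
          - (1 - t / β) * (t / β / (1 - t / β)) * γ) • e := by rw [h3, h4]; simp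
    _ = _ := by module

namespace IsDoubleCover

variable {ι : Type} {T : ι → Set Plane}

/-- Exactly two members through a generic point of a line reach above that line. -/
lemma encard_above (hT : IsDoubleCover T)
    (h2 : ∀ p : Plane, (∀ i, p ∉ frontier (T i)) → {i | p ∈ T i}.encard = 2)
    {f : StrongDual ℝ Plane} {u e p : Plane} (hu : 0 < f u)
    (hk : ∀ v, f v = 0 → ∃ s : ℝ, v = s • e)
    (hp : ∀ i, p ∈ T i → ∃ δ : ℝ, 0 < δ ∧ p + δ • e ∈ T i ∧ p - δ • e ∈ T i) :
    {i | p ∈ T i ∧ ∃ y ∈ T i, f p < f y}.encard = 2 := by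
  have hfin : {i | p ∈ T i ∧ ∃ y ∈ T i, f p < f y}.Finite :=
    (hT.finite_meet {p} Bornology.isBounded_singleton).subset fun i hi => ⟨p, hi.1, rfl⟩
  obtain ⟨ε, hε, hb⟩ := exists_ball_meet_imp_mem hT.isClosed hT.finite_meet p
  have h1 : ∀ᶠ t : ℝ in nhdsWithin 0 (Ioi 0), ∀ i ∈ {i | p ∈ T i ∧ ∃ y ∈ T i, f p < f y},
      p + t • u ∈ interior (T i) := by
    rw [Filter.eventually_all_finite hfin]
    rintro i ⟨hpi, y, hy, hfy⟩
    obtain ⟨δ, hδ, h1, h2⟩ := hp i hpi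
    exact eventually_add_smul_mem_interior (hT.convex i) (hT.interior_nonempty i) hu hk hδ h1 h2
      hy hfy
  obtain ⟨t₀, ht₀, hs⟩ := exists_pos_dist_add_smul_lt p u hε
  obtain ⟨t, ⟨ht1, ht2⟩, ht3⟩ := ((h1.and (nhdsWithin_le_nhds (Iio_mem_nhds ht₀))).and
    self_mem_nhdsWithin).exists
  have hpos : 0 < t := ht3
  have heq : {i | p ∈ T i ∧ ∃ y ∈ T i, f p < f y} = {i | p + t • u ∈ T i} := by
    ext i
    refine ⟨fun hi => mem_ofPred.2 (interior_subset (ht1 i hi)), fun hi => ⟨hb i _ hi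
      (hs t (by rw [abs_of_pos hpos]; exact (mem_Iio.1 ht2).le)), _, hi, ?_⟩⟩
    simp only [map_add, map_smul, smul_eq_mul]
    linarith [mul_pos hpos hu]
  rw [heq]
  refine h2 _ fun i hi => ?_
  have hmem : p + t • u ∈ T i := (hT.isClosed i).frontier_subset hi
  have : i ∈ {i | p ∈ T i ∧ ∃ y ∈ T i, f p < f y} := by rw [heq]; exact hmem
  exact hi.2 (ht1 i this)

/-- As many members lie below a line as above it at a generic point of that line. -/
lemma encard_top_eq_encard_bottom (hT : IsDoubleCover T)
    (h2 : ∀ p : Plane, (∀ i, p ∉ frontier (T i)) → {i | p ∈ T i}.encard = 2)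
    {f : StrongDual ℝ Plane} {u e p : Plane} (hu : 0 < f u)
    (hk : ∀ v, f v = 0 → ∃ s : ℝ, v = s • e)
    (hp : ∀ i, p ∈ T i → ∃ δ : ℝ, 0 < δ ∧ p + δ • e ∈ T i ∧ p - δ • e ∈ T i) :
    {i | p ∈ T i ∧ ∀ y ∈ T i, f y ≤ f p}.encard = {i | p ∈ T i ∧ ∀ y ∈ T i, f p ≤ f y}.encard := by
  have key : ∀ (f : StrongDual ℝ Plane) (u : Plane), 0 < f u →
      (∀ v, f v = 0 → ∃ s : ℝ, v = s • e) →
      {i | p ∈ T i ∧ ∀ y ∈ T i, f y ≤ f p}.encard + 2 = {i | p ∈ T i}.encard := by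
    intro f u hu hk
    rw [← hT.encard_above h2 hu hk hp, ← encard_union_eq]
    · congr 1
      ext i
      simp only [mem_union, mem_ofPred, ← and_or_left, and_iff_left_iff_imp]
      intro _
      by_contra! hcon
      obtain ⟨⟨y, hy, hlt⟩, h⟩ := hcon
      exact absurd (h y hy) (not_le.2 hlt)
    · rw [Set.disjoint_left]
      rintro i ⟨-, h⟩ ⟨-, y, hy, hlt⟩
      exact absurd (h y hy) (not_le.2 hlt)
  have h1 := key f u hu hk
  have h3 := key (-f) (-u) (by simpa using hu) (fun v hv => hk v (by simpa using hv))
  simp only [neg_apply, neg_le_neg_iff] at h3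
  exact (ENat.add_left_injective_of_ne_top (by simp)) (h1.trans h3.symm)

end IsDoubleCover

lemma tsum_ite_const {ι : Type} (P : ι → Prop) [DecidablePred P] (c : ℝ≥0∞) :
    ∑' i, (if P i then c else 0) = {i | P i}.encard * c := by
  rw [← ENNReal.tsum_set_one, ← ENNReal.tsum_mul_right, tsum_subtype {i | P i} fun _ => 1 * c]
  refine tsum_congr fun i => ?_
  by_cases h : P i <;> simp [h]

section Tiling

variable {K : Set Plane} {ι : Type} {x : ι → Plane}

lemma tsum_weight_ne_top (hK : IsConvexBody K)
    (hfin : ∀ B : Set Plane, Bornology.IsBounded B → {i | ((x i +ᵥ K) ∩ B).Nonempty}.Finite)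
    (h2 : ∀ p : Plane, (∀ i, p ∉ frontier (x i +ᵥ K)) → {i | p ∈ x i +ᵥ K}.encard = 2)
    {g : Plane → ℝ≥0∞} (hg : Measurable g) (hint : ∫⁻ p, g p ≠ ∞) {R : ℝ} (hR : ∀ y ∈ K, ‖y‖ ≤ R)
    {κ : ℝ≥0} (hκ : ∀ p q, dist p q ≤ R → g p ≤ κ * g q) : ∑' i, g (x i) ≠ ∞ := by
  classical
  have hT := hK.isDoubleCover hfin h2
  have : Countable ι :=
    countable_of_finite_meet (fun i => (hT.interior_nonempty i).mono interior_subset) hfin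
  have hmeas : ∀ i, MeasurableSet (x i +ᵥ K) := fun i => (hT.isClosed i).measurableSet
  have hsum : ∑' i, ∫⁻ p in x i +ᵥ K, g p = 2 * ∫⁻ p, g p := by
    rw [← lintegral_const_mul _ hg]
    simp_rw [← lintegral_indicator (hmeas _)]
    rw [← lintegral_tsum fun i => (hg.indicator (hmeas i)).aemeasurable]
    refine lintegral_congr_ae ?_
    have hae : ∀ᵐ p : Plane, ∀ i, p ∉ frontier (x i +ᵥ K) := by
      rw [ae_all_iff]
      intro i
      exact measure_eq_zero_iff_ae_notMem.1 ((hT.convex i).addHaar_frontier volume)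
    filter_upwards [hae] with p hp
    simp only [indicator_apply]
    rw [tsum_ite_const, h2 p hp]
    simp
  have hvol : volume K ≠ 0 := (Measure.measure_pos_of_nonempty_interior volume hK.2.2).ne'
  have hle : ∑' i, g (x i) * volume K ≤ κ * (2 * ∫⁻ p, g p) := by
    rw [← hsum, ← ENNReal.tsum_mul_left]
    refine ENNReal.tsum_le_tsum fun i => ?_
    rw [← lintegral_const_mul _ hg, ← measure_vadd volume (x i) K, ← setLIntegral_const]
    refine setLIntegral_mono' (hmeas i) ?_
    rintro _ ⟨y, hy, rfl⟩
    refine hκ _ _ ?_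
    simpa [dist_eq_norm] using hR y hy
  rw [ENNReal.tsum_mul_right] at hle
  intro htop
  rw [htop, ENNReal.top_mul hvol, top_le_iff] at hle
  exact ENNReal.mul_ne_top ENNReal.coe_ne_top (ENNReal.mul_ne_top (by simp) hint) hle

/-- The weighted total length of top edges in a fixed direction equals that of bottom edges. -/
lemma tsum_top_eq_tsum_bottom (hK : IsConvexBody K)
    (hfin : ∀ B : Set Plane, Bornology.IsBounded B → {i | ((x i +ᵥ K) ∩ B).Nonempty}.Finite)
    (h2 : ∀ p : Plane, (∀ i, p ∉ frontier (x i +ᵥ K)) → {i | p ∈ x i +ᵥ K}.encard = 2)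
    {g : Plane → ℝ≥0∞} (hg : Measurable g) {f : StrongDual ℝ Plane} {u e : Plane} (hu : f u = 1)
    (he : f e = 0) (hk : ∀ v, f v = 0 → ∃ s : ℝ, v = s • e) {q r : Plane} (hq : q ∈ K) (hr : r ∈ K)
    (hmax : ∀ y ∈ K, f y ≤ f q) (hmin : ∀ y ∈ K, f r ≤ f y) :
    ∑' i, ∫⁻ s : ℝ in {s | f (x i + q) • u + s • e ∈ x i +ᵥ K}, g (f (x i + q) • u + s • e) =
    ∑' i, ∫⁻ s : ℝ in {s | f (x i + r) • u + s • e ∈ x i +ᵥ K}, g (f (x i + r) • u + s • e) := by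
  classical
  have hT := hK.isDoubleCover hfin h2
  have : Countable ι :=
    countable_of_finite_meet (fun i => (hT.interior_nonempty i).mono interior_subset) hfin
  have hcont : ∀ c : ℝ, Continuous fun s : ℝ => c • u + s • e := fun c => by fun_prop
  have hmeas : ∀ (c : ℝ) i, MeasurableSet {s : ℝ | c • u + s • e ∈ x i +ᵥ K} := fun c i =>
    ((hT.isClosed i).preimage (hcont c)).measurableSet
  have hgm : ∀ c : ℝ, Measurable fun s : ℝ => g (c • u + s • e) := fun c =>
    hg.comp (hcont c).measurable
  have hline : ∀ q : Plane,
      ∑' i, ∫⁻ s : ℝ in {s | f (x i + q) • u + s • e ∈ x i +ᵥ K}, g (f (x i + q) • u + s • e) =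
      ∑' c : ℝ, ∫⁻ s : ℝ, {i | c = f (x i + q) ∧ c • u + s • e ∈ x i +ᵥ K}.encard *
        g (c • u + s • e) := by
    intro q
    have h1 : ∀ i, ∫⁻ s : ℝ in {s | f (x i + q) • u + s • e ∈ x i +ᵥ K},
        g (f (x i + q) • u + s • e) = ∑' c : ℝ, if c = f (x i + q) then
          ∫⁻ s : ℝ in {s | c • u + s • e ∈ x i +ᵥ K}, g (c • u + s • e) else 0 := fun i => by
      rw [tsum_ite_eq (f (x i + q)) fun c : ℝ =>
          ∫⁻ s : ℝ in {s | c • u + s • e ∈ x i +ᵥ K}, g (c • u + s • e)]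
    rw [tsum_congr h1, ENNReal.tsum_comm]
    refine tsum_congr fun c => ?_
    simp_rw [← tsum_ite_const]
    rw [lintegral_tsum]
    · refine tsum_congr fun i => ?_
      by_cases hc : c = f (x i + q)
      · simp only [hc, if_true, true_and]
        rw [← lintegral_indicator (hmeas _ i)]
        rfl
      · simp only [hc, false_and, if_false]; simp
    · intro i
      by_cases hc : c = f (x i + q)
      · simp only [hc, true_and]
        exact ((hgm _).indicator (hmeas _ i)).aemeasurable
      · simp only [hc, false_and, if_false]; simp
  rw [hline q, hline r]
  refine tsum_congr fun c => lintegral_congr_ae ?_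
  have hae : ∀ᵐ s : ℝ, ∀ i, s ∉ frontier {s : ℝ | c • u + s • e ∈ x i +ᵥ K} := by
    rw [ae_all_iff]
    intro i
    refine measure_eq_zero_iff_ae_notMem.1 (Convex.addHaar_frontier volume ?_)
    intro s hs t ht a b ha hb hab
    have := hT.convex i hs ht ha hb hab
    rw [mem_ofPred]
    convert this using 1
    calc c • u + (a • s + b • t) • e = ((a + b) * c) • u + (a • s + b • t) • e := by
          rw [hab, one_mul]
      _ = _ := by simp only [smul_eq_mul]; module
  filter_upwards [hae] with s hs
  have hfp : f (c • u + s • e) = c := by simp [hu, he]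
  have htop : {i | c = f (x i + q) ∧ c • u + s • e ∈ x i +ᵥ K} = {i | c • u + s • e ∈ x i +ᵥ K ∧
      ∀ y ∈ x i +ᵥ K, f y ≤ f (c • u + s • e)} := by
    ext i
    rw [mem_ofPred, mem_ofPred, hfp, and_comm]
    refine and_congr_right fun hp => ⟨?_, fun h => ?_⟩
    · rintro rfl _ ⟨y, hy, rfl⟩
      simpa using hmax y hy
    · refine le_antisymm ?_ (h _ ⟨q, hq, rfl⟩)
      obtain ⟨y, hy, hy'⟩ := hp
      rw [← hfp, ← hy']
      simpa using hmax y hy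
  have hbot : {i | c = f (x i + r) ∧ c • u + s • e ∈ x i +ᵥ K} = {i | c • u + s • e ∈ x i +ᵥ K ∧
      ∀ y ∈ x i +ᵥ K, f (c • u + s • e) ≤ f y} := by
    ext i
    rw [mem_ofPred, mem_ofPred, hfp, and_comm]
    refine and_congr_right fun hp => ⟨?_, fun h => ?_⟩
    · rintro rfl _ ⟨y, hy, rfl⟩
      simpa using hmin y hy
    · refine le_antisymm (h _ ⟨r, hr, rfl⟩) ?_
      obtain ⟨y, hy, hy'⟩ := hp
      rw [← hfp, ← hy']
      simpa using hmin y hy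
  rw [htop, hbot, hT.encard_top_eq_encard_bottom h2 (by rw [hu]; exact one_pos) hk]
  intro i hi
  have hint : s ∈ interior {s : ℝ | c • u + s • e ∈ x i +ᵥ K} := by
    by_contra hc
    exact hs i ⟨subset_closure hi, hc⟩
  obtain ⟨δ, hδ, hb⟩ := Metric.isOpen_iff.1 isOpen_interior s hint
  have hab : |δ / 2| < δ := by rw [abs_of_pos (by linarith)]; linarith
  refine ⟨δ / 2, by linarith, ?_, ?_⟩
  · have := interior_subset (hb (show s + δ / 2 ∈ _ by
      simpa only [Metric.mem_ball, Real.dist_eq, add_sub_cancel_left] using hab))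
    rw [mem_ofPred, add_smul, ← add_assoc] at this
    exact this
  · have := interior_subset (hb (show s - δ / 2 ∈ _ by
      simpa only [Metric.mem_ball, Real.dist_eq, sub_sub_cancel_left, abs_neg] using hab))
    rw [mem_ofPred, sub_smul, ← add_sub_assoc] at this
    exact this

lemma volume_top_le_volume_bottom [Nonempty ι] (hK : IsConvexBody K)
    (hfin : ∀ B : Set Plane, Bornology.IsBounded B → {i | ((x i +ᵥ K) ∩ B).Nonempty}.Finite)
    (h2 : ∀ p : Plane, (∀ i, p ∉ frontier (x i +ᵥ K)) → {i | p ∈ x i +ᵥ K}.encard = 2)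
    {f : StrongDual ℝ Plane} {e : Plane} (hf : f ≠ 0) (he0 : e ≠ 0)
    (he : f e = 0) {q r : Plane} (hq : q ∈ K) (hr : r ∈ K)
    (hmax : ∀ y ∈ K, f y ≤ f q) (hmin : ∀ y ∈ K, f r ≤ f y) :
    volume {s : ℝ | q + s • e ∈ K} ≤ volume {s : ℝ | r + s • e ∈ K} := by
  have hk := exists_eq_smul_of_apply_eq_zero hf he0 he
  obtain ⟨u, hu⟩ : ∃ u, f u = 1 := by
    obtain ⟨w, hw⟩ := exists_apply_ne_zero hf
    exact ⟨(f w)⁻¹ • w, by simp [hw]⟩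
  obtain ⟨R, hR⟩ := hK.1.isBounded.exists_norm_le
  have hR0 : 0 ≤ R := (norm_nonneg q).trans (hR q hq)
  have hcl : ∀ i, IsClosed (x i +ᵥ K) := fun i => hK.1.isClosed.vadd (x i)
  have hvol : ∀ (i : ι) (q : Plane), volume {s : ℝ | f (x i + q) • u + s • e ∈ x i +ᵥ K} =
      volume {s : ℝ | q + s • e ∈ K} := by
    intro i q
    obtain ⟨η, hη⟩ := hk (f (x i + q) • u - (x i + q)) (by simp [hu])
    rw [← measure_preimage_add_right volume η {s : ℝ | q + s • e ∈ K}]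
    congr 1
    ext s
    rw [mem_ofPred, mem_preimage, mem_ofPred]
    have : f (x i + q) • u = x i + q + η • e := by rw [← hη]; abel
    have h3 : x i + q + η • e + s • e = x i + (q + (s + η) • e) := by module
    rw [this, h3, ← vadd_eq_add (x i), Set.vadd_mem_vadd_set_iff]
  have key : ∀ κ : ℝ≥0, 1 < κ →
      volume {s : ℝ | q + s • e ∈ K} ≤ (κ : ℝ≥0∞) ^ 2 * volume {s : ℝ | r + s • e ∈ K} := by
    intro κ hκ
    obtain ⟨g, hg, hg0, hint, hκg⟩ := exists_slowly_varying_weight hR0 hκ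
    have hS := tsum_weight_ne_top hK hfin h2 hg hint hR hκg
    have hS0 : ∑' i, g (x i) ≠ 0 := fun h =>
      hg0 _ (ENNReal.tsum_eq_zero.1 h (Classical.arbitrary ι))
    have hmeas : ∀ (c : ℝ) i, MeasurableSet {s : ℝ | c • u + s • e ∈ x i +ᵥ K} := fun c i =>
      ((hcl i).preimage (by fun_prop)).measurableSet
    have hgm : ∀ c : ℝ, Measurable fun s : ℝ => g (c • u + s • e) := fun c =>
      hg.comp (Continuous.measurable (by fun_prop))
    have hdist : ∀ i, ∀ p ∈ x i +ᵥ K, dist p (x i) ≤ R := by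
      rintro i _ ⟨y, hy, rfl⟩
      simpa [dist_eq_norm] using hR y hy
    have h1 : (∑' i, g (x i)) * volume {s : ℝ | q + s • e ∈ K} ≤ κ * ∑' i,
        ∫⁻ s : ℝ in {s | f (x i + q) • u + s • e ∈ x i +ᵥ K}, g (f (x i + q) • u + s • e) := by
      rw [← ENNReal.tsum_mul_right, ← ENNReal.tsum_mul_left]
      refine ENNReal.tsum_le_tsum fun i => ?_
      rw [← lintegral_const_mul _ (hgm _), ← hvol i q, ← setLIntegral_const]
      refine setLIntegral_mono' (hmeas _ i) fun s hs => hκg _ _ ?_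
      rw [dist_comm]
      exact hdist i _ hs
    have h3 : ∑' i, ∫⁻ s : ℝ in {s | f (x i + r) • u + s • e ∈ x i +ᵥ K},
        g (f (x i + r) • u + s • e) ≤
        κ * ((∑' i, g (x i)) * volume {s : ℝ | r + s • e ∈ K}) := by
      rw [← ENNReal.tsum_mul_right, ← ENNReal.tsum_mul_left]
      refine ENNReal.tsum_le_tsum fun i => ?_
      rw [← hvol i r, ← mul_assoc, ← setLIntegral_const]
      exact setLIntegral_mono' (hmeas _ i) fun s hs => hκg _ _ (hdist i _ hs)
    rw [tsum_top_eq_tsum_bottom hK hfin h2 hg hu he hk hq hr hmax hmin] at h1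
    refine (ENNReal.mul_le_mul_iff_right hS0 hS).1 (h1.trans ?_)
    calc _ ≤ (κ : ℝ≥0∞) * (κ * ((∑' i, g (x i)) * volume {s : ℝ | r + s • e ∈ K})) := by gcongr
      _ = _ := by ring
  have hlim : Filter.Tendsto
      (fun κ : ℝ≥0 => (κ : ℝ≥0∞) ^ 2 * volume {s : ℝ | r + s • e ∈ K}) (nhdsWithin 1 (Ioi 1))
      (nhds ((1 : ℝ≥0∞) ^ 2 * volume {s : ℝ | r + s • e ∈ K})) := by
    refine ENNReal.Tendsto.mul_const ?_ (Or.inl (by simp))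
    have : Filter.Tendsto (fun κ : ℝ≥0 => (κ : ℝ≥0∞) ^ 2) (nhds 1) (nhds ((1 : ℝ≥0) ^ 2)) :=
      ENNReal.Tendsto.pow (ENNReal.tendsto_coe.2 Filter.tendsto_id)
    exact this.mono_left nhdsWithin_le_nhds
  have := ge_of_tendsto hlim (Filter.eventually_of_mem self_mem_nhdsWithin fun κ hκ => key κ hκ)
  simpa using this

/-- A twofold tiling by translates of `K` forces opposite edges of `K` to be equal. -/
theorem exists_hasEdgePair [Nonempty ι] (hK : IsConvexBody K)
    (hfin : ∀ B : Set Plane, Bornology.IsBounded B → {i | ((x i +ᵥ K) ∩ B).Nonempty}.Finite)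
    (h2 : ∀ p : Plane, (∀ i, p ∉ frontier (x i +ᵥ K)) → {i | p ∈ x i +ᵥ K}.encard = 2)
    {f : StrongDual ℝ Plane} (hf : f ≠ 0) (hnt : (f.toExposed K).Nontrivial) :
    ∃ e, HasEdgePair K f e := by
  obtain ⟨q, hq, q', hq', hne⟩ := hnt
  have hd : q' - q ≠ 0 := sub_ne_zero.2 hne.symm
  have hmax := hq.2
  obtain ⟨r, hr, hmin⟩ := hK.1.exists_isMinOn ⟨q, hq.1⟩ f.continuous.continuousOn
  replace hmin : ∀ y ∈ K, f r ≤ f y := fun y hy => hmin hy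
  set d := q' - q with hdd
  have hfd : f d = 0 := by
    have h1 := hq.2 q' hq'.1
    have h2 := hq'.2 q hq.1
    simp only [hdd, map_sub]; linarith
  have hk := exists_eq_smul_of_apply_eq_zero hf hd hfd
  have hvol : volume {s : ℝ | q + s • d ∈ K} = volume {s : ℝ | r + s • d ∈ K} := by
    refine le_antisymm (volume_top_le_volume_bottom hK hfin h2 hf hd hfd hq.1 hr hmax hmin)
      (volume_top_le_volume_bottom hK hfin h2 (neg_ne_zero.2 hf) hd (by simpa using hfd) hr hq.1
        (fun y hy => by simpa using hmin y hy) (fun y hy => by simpa using hmax y hy))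
  have hseg : ∀ q ∈ K, ∃ a b : ℝ, a ≤ b ∧ {s : ℝ | q + s • d ∈ K} = Icc a b := by
    intro q hq
    have hconv : Convex ℝ {s : ℝ | q + s • d ∈ K} := by
      intro s hs t ht a b ha hb hab
      have := hK.2.1 hs ht ha hb hab
      rw [mem_ofPred]
      convert this using 1
      calc q + (a • s + b • t) • d = (a + b) • q + (a • s + b • t) • d := by
            rw [hab, one_smul]
        _ = _ := by simp only [smul_eq_mul]; module
    have hclosed : IsClosed {s : ℝ | q + s • d ∈ K} := hK.1.isClosed.preimage (by fun_prop)
    obtain ⟨R, hR⟩ := hK.1.isBounded.exists_norm_le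
    have hbdd : Bornology.IsBounded {s : ℝ | q + s • d ∈ K} := by
      refine (Metric.isBounded_closedBall (x := (0 : ℝ)) (r := (R + ‖q‖) / ‖d‖)).subset ?_
      intro s hs
      rw [mem_closedBall_zero_iff, le_div_iff₀ (norm_pos_iff.2 hd), ← norm_smul]
      have h1 := norm_sub_le (q + s • d) q
      have h2 := hR _ hs
      rw [add_sub_cancel_left] at h1
      linarith
    have hcomp := Metric.isCompact_of_isClosed_isBounded hclosed hbdd
    have hne : {s : ℝ | q + s • d ∈ K}.Nonempty := ⟨0, by simpa using hq⟩
    have hIcc := eq_Icc_of_connected_compact ⟨hne, hconv.isPreconnected⟩ hcomp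
    refine ⟨_, _, ?_, hIcc⟩
    rw [hIcc] at hne
    exact nonempty_Icc.1 hne
  obtain ⟨a, b, hab, hIq⟩ := hseg q hq.1
  obtain ⟨a', b', hab', hIr⟩ := hseg r hr
  have hlen : b - a = b' - a' := by
    rw [hIq, hIr, Real.volume_Icc, Real.volume_Icc] at hvol
    exact (ENNReal.ofReal_eq_ofReal_iff (by linarith) (by linarith)).1 hvol
  have hpos : 0 < b - a := by
    have h0 : (0 : ℝ) ∈ Icc a b := hIq ▸ (by simpa using hq.1)
    have h1 : (1 : ℝ) ∈ Icc a b := hIq ▸ (by simpa [hdd] using hq'.1)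
    linarith [h0.1, h1.2]
  have hface : ∀ (f : StrongDual ℝ Plane) (q : Plane) (a b : ℝ), q ∈ K → (∀ y ∈ K, f y ≤ f q) →
      f d = 0 → (∀ v, f v = 0 → ∃ s : ℝ, v = s • d) → a < b → {s : ℝ | q + s • d ∈ K} = Icc a b →
      f.toExposed K = segment ℝ (q + a • d) (q + a • d + (b - a) • d) := by
    intro f q a b hq hmax hfd hk hab hI
    ext y
    rw [mem_segment_add]
    constructor
    · rintro ⟨hy, hy'⟩
      obtain ⟨s, hs⟩ := hk (y - q) (by
        rw [map_sub, sub_eq_zero]; exact le_antisymm (hmax y hy) (hy' q hq))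
      have hys : y = q + s • d := by rw [← hs]; abel
      have hsI : s ∈ Icc a b := by rw [← hI, mem_ofPred, ← hys]; exact hy
      refine ⟨(s - a) / (b - a), div_nonneg (by linarith [hsI.1]) (by linarith),
        (div_le_one (by linarith)).2 (by linarith [hsI.2]), ?_⟩
      rw [hys, smul_smul, div_mul_cancel₀ _ (by linarith)]
      module
    · rintro ⟨s, hs0, hs1, rfl⟩
      have hsI : a + s * (b - a) ∈ Icc a b := ⟨by nlinarith, by nlinarith⟩
      rw [← hI, mem_ofPred] at hsI
      refine ⟨?_, fun z hz => ?_⟩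
      · convert hsI using 1; module
      · simpa [hfd] using hmax z hz
  refine ⟨(b - a) • d, smul_ne_zero hpos.ne' hd, by simp [hfd], q + a • d, r + a' • d,
    hface f q a b hq.1 hmax hfd hk (by linarith) hIq, ?_⟩
  rw [hlen]
  exact hface (-f) r a' b' hr (fun y hy => by simpa using hmin y hy) (by simpa using hfd)
    (fun v hv => hk v (by simpa using hv)) (by linarith) hIr

end Tiling

section Polygon

variable {K : Set Plane}

lemma toExposed_vadd (g : StrongDual ℝ Plane) (a : Plane) (A : Set Plane) :
    g.toExposed (a +ᵥ A) = a +ᵥ g.toExposed A := by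
  ext p
  rw [mem_vadd_set_iff_neg_vadd_mem]
  simp only [ContinuousLinearMap.toExposed, mem_ofPred, mem_vadd_set_iff_neg_vadd_mem, vadd_eq_add]
  refine and_congr_right fun _ => ⟨fun h y hy => ?_, fun h y hy => ?_⟩
  · have := h (a + y) (by simpa using hy)
    simp only [map_add, map_neg] at this ⊢
    linarith
  · have := h _ hy
    simp only [map_add, map_neg] at this
    linarith

lemma segment_vadd (a q e : Plane) :
    a +ᵥ segment ℝ q (q + e) = segment ℝ (a + q) (a + q + e) := by
  ext p
  rw [mem_vadd_set_iff_neg_vadd_mem, mem_segment_add, mem_segment_add]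
  refine exists_congr fun s => and_congr_right fun _ => and_congr_right fun _ => ?_
  rw [vadd_eq_add, neg_add_eq_iff_eq_add, add_assoc]

lemma HasEdgePair.vadd {f : StrongDual ℝ Plane} {e : Plane} (h : HasEdgePair K f e) (a : Plane) :
    HasEdgePair (a +ᵥ K) f e := by
  obtain ⟨he, hfe, q, r, hq, hr⟩ := h
  exact ⟨he, hfe, a + q, a + r, by rw [toExposed_vadd, hq, segment_vadd],
    by rw [toExposed_vadd, hr, segment_vadd]⟩

lemma toExposed_smul (g : StrongDual ℝ Plane) {c : ℝ} (hc : 0 < c) (A : Set Plane) :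
    (c • g).toExposed A = g.toExposed A := by
  ext p
  simp only [ContinuousLinearMap.toExposed, mem_ofPred, FunLike.coe_smul,
    Pi.smul_apply, smul_eq_mul, mul_le_mul_iff_right₀ hc]

/-- Functionals with a common nonzero kernel vector are proportional. -/
lemma exists_smul_eq_of_ker {f g : StrongDual ℝ Plane} (hf : f ≠ 0) (hg : g ≠ 0) {e : Plane}
    (he : e ≠ 0) (hfe : f e = 0) (hge : g e = 0) : ∃ c : ℝ, c ≠ 0 ∧ g = c • f := by
  obtain ⟨u, hu⟩ := exists_apply_ne_zero hf
  have key : g = (g u / f u) • f := by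
    ext w
    obtain ⟨s, hs⟩ := exists_eq_smul_of_apply_eq_zero hf he hfe (w - (f w / f u) • u)
      (by simp [hu])
    have : w = (f w / f u) • u + s • e := by rw [← hs]; abel
    have h1 : g w = f w / f u * g u := by
      conv_lhs => rw [this]
      simp [hge]
    rw [h1]
    simp only [FunLike.coe_smul, Pi.smul_apply, smul_eq_mul]
    ring
  refine ⟨_, fun h => hg ?_, key⟩
  rw [key, h, zero_smul]

/-- The nondegenerate edges of `K`. -/
def edges (K : Set Plane) : Set (Set Plane) :=
  {F | F.Nontrivial ∧ ∃ g : StrongDual ℝ Plane, g ≠ 0 ∧ g.toExposed K = F}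

/-- A set without four edges in pairwise nonparallel directions has at most six edges. -/
lemma edges_finite_and_ncard_le
    (h4 : ∀ f : Fin 4 → StrongDual ℝ Plane, (∀ k, f k ≠ 0) →
      (∀ k, ((f k).toExposed K).Nontrivial) → ∃ k l, k ≠ l ∧ ∃ x, f k x = 0 ∧ f l x = 0 ∧ x ≠ 0) :
    (edges K).Finite ∧ (edges K).ncard ≤ 6 := by
  let Q : ℕ → Prop := fun n => ∃ f : Fin n → StrongDual ℝ Plane, (∀ k, f k ≠ 0) ∧
    (∀ k, ((f k).toExposed K).Nontrivial) ∧ ∀ k l, k ≠ l → ∀ x, f k x = 0 → f l x = 0 → x = 0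
  have hQ4 : ¬ Q 4 := by
    rintro ⟨f, h1, h2, h3⟩
    obtain ⟨k, l, hkl, x, hk, hl, hx⟩ := h4 f h1 h2
    exact hx (h3 k l hkl x hk hl)
  have hQ0 : Q 0 := ⟨fun _ => 0, by simp, fun k => k.elim0, fun k => k.elim0⟩
  obtain ⟨n, hn, ⟨f, hf0, hfn, hfp⟩, hn'⟩ : ∃ n ≤ 3, Q n ∧ ¬ Q (n + 1) := by
    by_contra! hcon
    exact hQ4 (hcon 3 le_rfl (hcon 2 (by simp) (hcon 1 (by simp) (hcon 0 (by simp) hQ0))))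
  classical
  let S : Finset (Set Plane) := (Finset.univ : Finset (Fin n)).image (fun k => (f k).toExposed K) ∪
    (Finset.univ : Finset (Fin n)).image (fun k => (-f k).toExposed K)
  have hS : S.card ≤ 6 := by
    refine (Finset.card_union_le _ _).trans ?_
    have h1 : ((Finset.univ : Finset (Fin n)).image (fun k => (f k).toExposed K)).card ≤ n :=
      Finset.card_image_le.trans (by simp)
    have h2 : ((Finset.univ : Finset (Fin n)).image (fun k => (-f k).toExposed K)).card ≤ n :=
      Finset.card_image_le.trans (by simp)
    omega
  have hsub : edges K ⊆ S := by
    rintro F ⟨hF, g, hg, rfl⟩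
    obtain ⟨k, x, hx, hgx, hfx⟩ : ∃ k x, x ≠ 0 ∧ g x = 0 ∧ f k x = 0 := by
      by_contra! hcon
      refine hn' ⟨Fin.cons g f, ?_, ?_, ?_⟩
      · intro k
        refine Fin.cases ?_ (fun k => ?_) k
        · simpa using hg
        · simpa using hf0 k
      · intro k
        refine Fin.cases ?_ (fun k => ?_) k
        · simpa using hF
        · simpa using hfn k
      · intro k l
        refine Fin.cases ?_ (fun k => ?_) k <;> refine Fin.cases ?_ (fun l => ?_) l
        · simp
        · intro _ x h1 h2
          by_contra hx
          exact hcon l x hx (by simpa using h1) (by simpa using h2)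
        · intro _ x h1 h2
          by_contra hx
          exact hcon k x hx (by simpa using h2) (by simpa using h1)
        · intro hkl x h1 h2
          exact hfp k l (fun h => hkl (by rw [h])) x (by simpa using h1) (by simpa using h2)
    obtain ⟨c, hc, rfl⟩ := exists_smul_eq_of_ker (hf0 k) hg hx hfx hgx
    rw [Finset.mem_coe, Finset.mem_union, Finset.mem_image, Finset.mem_image]
    rcases hc.lt_or_gt with hc | hc
    · refine Or.inr ⟨k, Finset.mem_univ _, ?_⟩
      rw [← toExposed_smul (-f k) (neg_pos.2 hc), neg_smul_neg]
    · exact Or.inl ⟨k, Finset.mem_univ _, (toExposed_smul _ hc _).symm⟩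
  refine ⟨S.finite_toSet.subset hsub, (ncard_le_ncard hsub S.finite_toSet).trans ?_⟩
  rwa [ncard_coe_finset]

/-- Near an extreme point lying on a proper face there are boundary points off that face. -/
lemma exists_near_notMem_face (hcl : IsClosed K) (hconv : Convex ℝ K)
    {v : Plane} (hv : v ∈ K.extremePoints ℝ) {g : StrongDual ℝ Plane} (hg : g ≠ 0)
    (hint : (interior K).Nonempty) (hvg : v ∈ g.toExposed K) {ε : ℝ} (hε : 0 < ε) :
    ∃ y, dist y v < ε ∧ y ∈ K ∧ y ∉ interior K ∧ y ∉ g.toExposed K := by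
  by_contra! hcon
  obtain ⟨u, hu⟩ := exists_apply_ne_zero hg
  set W := Metric.ball v ε ∩ {y | g y < g v}
  have hWc : IsPreconnected W :=
    ((convex_ball v ε).inter (convex_halfSpace_lt g.isLinear _)).isPreconnected
  have hWK : ∀ y ∈ W, y ∈ K → y ∈ interior K := by
    intro y hy hyK
    by_contra hyi
    exact absurd ((hcon y hy.1 hyK hyi).2 v hvg.1) (not_le.2 hy.2)
  have hlow : ∀ y ∈ interior K, g y < g v := by
    intro y hy
    obtain ⟨δ, hδ, hb⟩ := Metric.isOpen_iff.1 isOpen_interior y hy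
    obtain ⟨s, hs0, hs⟩ := exists_pos_dist_add_smul_lt y ((g u) • u) hδ
    have h1 := hvg.2 _ (interior_subset (hb (Metric.mem_ball.2 (hs s (abs_of_pos hs0).le))))
    simp only [map_add, map_smul, smul_eq_mul] at h1
    nlinarith [mul_pos hs0 (mul_self_pos.2 hu)]
  have hWne : (W ∩ interior K).Nonempty := by
    have : v ∈ closure (interior K) := by
      rw [hconv.closure_interior_eq_closure_of_nonempty_interior hint]; exact subset_closure hvg.1
    obtain ⟨y, hy, hyd⟩ := Metric.mem_closure_iff.1 this ε hε
    exact ⟨y, ⟨Metric.mem_ball.2 (by rwa [dist_comm]), hlow y hy⟩, hy⟩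
  have hWint : W ⊆ interior K := by
    refine hWc.subset_left_of_subset_union isOpen_interior hcl.isOpen_compl ?_ ?_ hWne
    · exact disjoint_compl_right.mono_left interior_subset
    · intro y hy
      by_cases hyK : y ∈ K
      · exact Or.inl (hWK y hy hyK)
      · exact Or.inr hyK
  exact notMem_extremePoints_of_half_ball hcl hg hε (fun y hy hgy =>
    interior_subset (hWint ⟨Metric.mem_ball.2 hy, hgy⟩)) hv

/-- If finitely many proper faces cover the boundary, every extreme point is on two edges. -/
lemma exists_two_edges (hcl : IsClosed K) (hconv : Convex ℝ K) (hint : (interior K).Nonempty)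
    {G : Set (StrongDual ℝ Plane)} (hG : G.Finite) (hG0 : ∀ g ∈ G, g ≠ 0)
    (hcov : ∀ p ∈ K, p ∉ interior K → ∃ g ∈ G, p ∈ g.toExposed K)
    {v : Plane} (hv : v ∈ K.extremePoints ℝ) :
    ∃ E ∈ edges K, ∃ F ∈ edges K, E ≠ F ∧ v ∈ E ∧ v ∈ F := by
  have hGcl : IsClosed (⋃ g ∈ G ∩ {g | v ∉ g.toExposed K}, g.toExposed K) :=
    (hG.inter_of_left _).isClosed_biUnion fun g _ =>
      (ContinuousLinearMap.toExposed.isExposed (l := g)).isClosed hcl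
  obtain ⟨ε, hε, hb⟩ := Metric.isOpen_iff.1 hGcl.isOpen_compl v (by simp)
  have step : ∀ g : StrongDual ℝ Plane, g ≠ 0 → v ∈ g.toExposed K →
      ∃ g' : StrongDual ℝ Plane, g' ≠ 0 ∧ v ∈ g'.toExposed K ∧ (g'.toExposed K).Nontrivial ∧
        g.toExposed K ≠ g'.toExposed K := by
    intro g hg hvg
    obtain ⟨y, hy, hyK, hyi, hyg⟩ := exists_near_notMem_face hcl hconv hv hg hint hvg hε
    obtain ⟨g', hg', hyg'⟩ := hcov y hyK hyi
    have hvg' : v ∈ g'.toExposed K := by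
      by_contra h
      exact hb (Metric.mem_ball.2 hy) (mem_biUnion (x := g') ⟨hg', h⟩ hyg')
    refine ⟨g', hG0 g' hg', hvg', ⟨y, hyg', v, hvg', ?_⟩, fun h => hyg (h ▸ hyg')⟩
    rintro rfl
    exact hyg hvg
  obtain ⟨g₀, hg₀, hv₀⟩ := hcov v hv.1 (notMem_interior_of_mem_extremePoints hv)
  obtain ⟨g₁, h1, hv1, hn1, -⟩ := step g₀ (hG0 _ hg₀) hv₀
  obtain ⟨g₂, h2, hv2, hn2, hne⟩ := step g₁ h1 hv1
  exact ⟨_, ⟨hn1, g₁, h1, rfl⟩, _, ⟨hn2, g₂, h2, rfl⟩, hne, hv1, hv2⟩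

lemma extremePoints_inter_edge_subset {F : Set Plane} (hF : IsExtreme ℝ K F) {q e : Plane}
    (h : F = segment ℝ q (q + e)) : K.extremePoints ℝ ∩ F ⊆ {q, q + e} := by
  rintro p ⟨hp, hpF⟩
  have h1 : p ∈ F.extremePoints ℝ := by
    rw [hF.extremePoints_eq]; exact ⟨hpF, hp⟩
  rw [h, ← convexHull_pair] at h1
  exact extremePoints_convexHull_subset h1

lemma extremePoints_finite_and_ncard_le (hfin : (edges K).Finite) (hcard : (edges K).ncard ≤ 6)
    (hedge : ∀ g : StrongDual ℝ Plane, g ≠ 0 → (g.toExposed K).Nontrivial →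
      ∃ e, HasEdgePair K g e)
    (htwo : ∀ v ∈ K.extremePoints ℝ, ∃ E ∈ edges K, ∃ F ∈ edges K, E ≠ F ∧ v ∈ E ∧ v ∈ F) :
    (K.extremePoints ℝ).Finite ∧ (K.extremePoints ℝ).ncard ≤ 6 := by
  have hend : ∀ F ∈ edges K, ∃ a b, K.extremePoints ℝ ∩ F ⊆ {a, b} := by
    rintro F ⟨hn, g, hg, rfl⟩
    obtain ⟨e, -, -, q, r, hq, -⟩ := hedge g hg hn
    exact ⟨q, q + e, extremePoints_inter_edge_subset (toExposed_isExtreme g K) hq⟩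
  have hext : (K.extremePoints ℝ).Finite := by
    refine (hfin.biUnion (t := fun F => K.extremePoints ℝ ∩ F) fun F hF => ?_).subset ?_
    · obtain ⟨a, b, h⟩ := hend F hF
      exact (toFinite {a, b}).subset h
    · intro v hv
      obtain ⟨E, hE, -, -, -, hvE, -⟩ := htwo v hv
      exact mem_biUnion hE ⟨hv, hvE⟩
  refine ⟨hext, ?_⟩
  classical
  have := Finset.card_mul_le_card_mul (s := hext.toFinset) (t := hfin.toFinset) (m := 2) (n := 2)
    (fun v F => v ∈ F) ?_ ?_
  · rw [← ncard_eq_toFinset_card _ hext, ← ncard_eq_toFinset_card _ hfin] at this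
    omega
  · intro v hv
    obtain ⟨E, hE, F, hF, hne, hvE, hvF⟩ := htwo v (hext.mem_toFinset.1 hv)
    rw [← Finset.card_pair hne]
    refine Finset.card_le_card ?_
    intro X hX
    rw [Finset.mem_bipartiteAbove, hfin.mem_toFinset]
    rcases Finset.mem_insert.1 hX with rfl | hX
    · exact ⟨hE, hvE⟩
    · rw [Finset.mem_singleton.1 hX]; exact ⟨hF, hvF⟩
  · intro F hF
    obtain ⟨a, b, h⟩ := hend F (hfin.mem_toFinset.1 hF)
    refine le_trans (Finset.card_le_card (t := {a, b}) ?_) Finset.card_le_two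
    intro v hv
    rw [Finset.mem_bipartiteBelow, hext.mem_toFinset] at hv
    simpa using h hv

end Polygon

section Symmetry

variable {K : Set Plane}

/-- Locally, the width function of a polygon with translation-equal opposite faces is linear. -/
lemma eventually_support_sub_eq {V : Set Plane} (hV : V.Finite) (hKV : K = convexHull ℝ V)
    (hext : V ⊆ K.extremePoints ℝ)
    {m : StrongDual ℝ Plane → Plane} (hmK : ∀ w, m w ∈ K)
    (hm : ∀ w : StrongDual ℝ Plane, ∀ y ∈ K, w y ≤ w (m w))
    {u : StrongDual ℝ Plane} {q r d : Plane} (hq : u.toExposed K = segment ℝ q (q + d))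
    (hr : (-u).toExposed K = segment ℝ r (r + d)) :
    ∀ᶠ w in nhds u, w (m w) + w (m (-w)) = w (q + r + d) := by
  have key : ∀ (u : StrongDual ℝ Plane) (q : Plane), u.toExposed K = segment ℝ q (q + d) →
      ∀ᶠ w in nhds u, w (m w) = max (w q) (w (q + d)) := by
    intro u q hq
    have hqF : q ∈ u.toExposed K := hq ▸ left_mem_segment ℝ _ _
    have hqdF : q + d ∈ u.toExposed K := hq ▸ right_mem_segment ℝ _ _
    have hev : ∀ᶠ w in nhds u, ∀ x ∈ V, w x ≤ max (w q) (w (q + d)) := by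
      rw [Filter.eventually_all_finite hV]
      intro x hx
      by_cases hxF : x ∈ u.toExposed K
      · refine Filter.Eventually.of_forall fun w => ?_
        rcases extremePoints_inter_edge_subset (toExposed_isExtreme u K) hq
          ⟨hext hx, hxF⟩ with h | h
        · rw [h]; exact le_max_left _ _
        · rw [h]; exact le_max_right _ _
      · have hlt : u x < u q := by
          by_contra! h
          exact hxF ⟨(hext hx).1, fun y hy => (hqF.2 y hy).trans h⟩
        have h1 : Continuous fun w : StrongDual ℝ Plane => w x := by fun_prop
        have h2 : Continuous fun w : StrongDual ℝ Plane => w q := by fun_prop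
        filter_upwards [h1.continuousAt.eventually_lt h2.continuousAt hlt] with w hw
        exact hw.le.trans (le_max_left _ _)
    filter_upwards [hev] with w hw
    refine le_antisymm ?_ (max_le (hm w q hqF.1) (hm w _ hqdF.1))
    have hsub : K ⊆ {y | w y ≤ max (w q) (w (q + d))} := by
      rw [hKV]
      exact convexHull_min hw (convex_halfSpace_le w.isLinear _)
    exact hsub (hmK w)
  have hneg : Filter.Tendsto (fun w : StrongDual ℝ Plane => -w) (nhds u) (nhds (-u)) :=
    continuous_neg.tendsto u
  filter_upwards [key u q hq, hneg.eventually (key (-u) r hr)] with w h1 h2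
  simp only [neg_apply, map_add] at h1 h2 ⊢
  rw [h1, neg_eq_iff_eq_neg.1 h2]
  rcases le_total 0 (w d) with h | h
  · rw [max_eq_right (by linarith), max_eq_left (by linarith)]; ring
  · rw [max_eq_left (by linarith), max_eq_right (by linarith)]; ring

/-- A polygon whose opposite faces are translates of each other is centrally symmetric. -/
lemma exists_sub_mem (hK : IsConvexBody K) {V : Set Plane} (hV : V.Finite)
    (hKV : K = convexHull ℝ V) (hext : V ⊆ K.extremePoints ℝ)
    (hopp : ∀ u : StrongDual ℝ Plane, u ≠ 0 → ∃ q r d, u.toExposed K = segment ℝ q (q + d) ∧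
      (-u).toExposed K = segment ℝ r (r + d)) :
    ∃ c, ∀ y ∈ K, c - y ∈ K := by
  have hne : K.Nonempty := hK.2.2.mono interior_subset
  have hmax : ∀ w : StrongDual ℝ Plane, ∃ x ∈ K, ∀ y ∈ K, w y ≤ w x := fun w =>
    hK.1.exists_isMaxOn hne w.continuous.continuousOn
  choose m hmK hm using hmax
  have hloc : ∀ u : StrongDual ℝ Plane, u ≠ 0 →
      ∃ c, ∀ᶠ w in nhds u, w (m w) + w (m (-w)) = w c := by
    intro u hu
    obtain ⟨q, r, d, hq, hr⟩ := hopp u hu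
    exact ⟨_, eventually_support_sub_eq hV hKV hext hmK hm hq hr⟩
  have hrank : 1 < Module.rank ℝ (StrongDual ℝ Plane) := by
    have : Module.finrank ℝ (StrongDual ℝ Plane) = 2 := by
      rw [(InnerProductSpace.toDual ℝ Plane).toLinearEquiv.symm.finrank_eq]; simp
    rw [← Module.finrank_eq_rank, this]; norm_num
  have hconn := (isConnected_compl_singleton_of_one_lt_rank hrank (0 : StrongDual ℝ Plane))
  obtain ⟨u₀, hu₀⟩ := hconn.nonempty
  obtain ⟨c, hc⟩ := hloc u₀ hu₀
  have hsub : ({0}ᶜ : Set (StrongDual ℝ Plane)) ⊆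
      {u | ∀ᶠ w in nhds u, w (m w) + w (m (-w)) = w c} := by
    refine hconn.isPreconnected.subset_of_closure_inter_subset isOpen_setOfPred_eventually_nhds
      ⟨u₀, hu₀, hc⟩ ?_
    rintro u ⟨hucl, hu⟩
    obtain ⟨c', hc'⟩ := hloc u hu
    obtain ⟨w₀, hw₀, hw₀'⟩ := mem_closure_iff_nhds.1 hucl _ (eventually_eventually_nhds.2 hc')
    have heq : ∀ᶠ w in nhds w₀, w (c - c') = 0 := by
      filter_upwards [hw₀, hw₀'] with w h1 h2
      rw [map_sub, ← h1, ← h2, sub_self]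
    have hcc : c = c' := by
      by_contra hcc
      have hz : ∀ z : StrongDual ℝ Plane, z (c - c') = 0 := by
        intro z
        have hlim : Filter.Tendsto (fun t : ℝ => w₀ + t • z) (nhdsWithin 0 (Ioi 0)) (nhds w₀) := by
          have : Filter.Tendsto (fun t : ℝ => w₀ + t • z) (nhds 0) (nhds (w₀ + (0 : ℝ) • z)) :=
            Continuous.tendsto (by fun_prop) 0
          simp only [zero_smul, add_zero] at this
          exact this.mono_left nhdsWithin_le_nhds
        obtain ⟨t, ht, ht0⟩ := ((hlim.eventually heq).and self_mem_nhdsWithin).exists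
        have h0 := heq.self_of_nhds
        simp only [add_apply, smul_apply, h0,
          zero_add, smul_eq_mul] at ht
        exact (mul_eq_zero.1 ht).resolve_left (ne_of_gt ht0)
      exact hcc (sub_eq_zero.1 (SeparatingDual.eq_zero_of_forall_dual_eq_zero (R := ℝ) hz))
    exact hcc ▸ hc'
  refine ⟨c, fun y hy => ?_⟩
  by_contra hcy
  obtain ⟨w, s, hlt, hs⟩ := geometric_hahn_banach_closed_point hK.2.1 hK.1.isClosed hcy
  have hw0 : w ≠ 0 := by
    rintro rfl
    have := hlt y hy
    simp at this hs
    linarith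
  have h1 := (hsub hw0).self_of_nhds
  have h2 := hlt _ (hmK w)
  have h3 := hm (-w) y hy
  simp only [neg_apply, map_sub] at h3 hs
  linarith

lemma exists_image_eq (h : ∃ c : Plane, ∀ y ∈ K, c - y ∈ K) :
    ∃ c : Plane, (fun y => (2 : ℝ) • c - y) '' K = K := by
  obtain ⟨c, hc⟩ := h
  refine ⟨(1 / 2 : ℝ) • c, ?_⟩
  have h2 : (2 : ℝ) • (1 / 2 : ℝ) • c = c := by rw [smul_smul]; norm_num
  rw [h2]
  refine Subset.antisymm (image_subset_iff.2 hc) fun y hy => ⟨c - y, hc y hy, ?_⟩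
  simp

end Symmetry

section Tiling

variable {K : Set Plane} {ι : Type} {x : ι → Plane}

/-- Finitely many proper faces cover the boundary of a member of a double cover by translates. -/
lemma exists_finite_faces [Nonempty ι] (hK : IsConvexBody K)
    (hT : IsDoubleCover (fun i => x i +ᵥ K)) :
    ∃ G : Set (StrongDual ℝ Plane), G.Finite ∧ (∀ g ∈ G, g ≠ 0) ∧
      ∀ p ∈ K, p ∉ interior K → ∃ g ∈ G, p ∈ g.toExposed K := by
  obtain ⟨i⟩ := ‹Nonempty ι›
  have hJ := (hT.finite_meet (x i +ᵥ K) (hK.1.vadd (x i)).isBounded)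
  have hsep : ∀ j, ∃ g : StrongDual ℝ Plane,
      Disjoint (interior (x i +ᵥ K)) (interior (x j +ᵥ K)) →
      g ≠ 0 ∧ ∃ c, (∀ a ∈ x i +ᵥ K, g a ≤ c) ∧ ∀ b ∈ x j +ᵥ K, c ≤ g b := by
    intro j
    by_cases hd : Disjoint (interior (x i +ᵥ K)) (interior (x j +ᵥ K))
    · obtain ⟨g, c, hg, h1, h2⟩ := exists_separating (hT.convex i) (hT.convex j)
        (hT.interior_nonempty i) (hT.interior_nonempty j) hd
      exact ⟨g, fun _ => ⟨hg, c, h1, h2⟩⟩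
    · exact ⟨0, fun h => absurd h hd⟩
  choose g hg using hsep
  refine ⟨g '' ({j | ((x j +ᵥ K) ∩ (x i +ᵥ K)).Nonempty} ∩
    {j | Disjoint (interior (x i +ᵥ K)) (interior (x j +ᵥ K))}),
    (hJ.inter_of_left _).image g, ?_, ?_⟩
  · rintro _ ⟨j, ⟨-, hj⟩, rfl⟩
    exact (hg j hj).1
  · intro p hp hpi
    have hp' : x i +ᵥ p ∈ x i +ᵥ K := vadd_mem_vadd_set hp
    obtain ⟨j, hj, hd⟩ := hT.exists_disjoint_neighbour (i := i) hp'
      (by rwa [interior_vadd, vadd_mem_vadd_set_iff])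
    obtain ⟨-, c, h1, h2⟩ := hg j hd
    refine ⟨g j, ⟨j, ⟨⟨_, hj, hp'⟩, hd⟩, rfl⟩, ?_⟩
    rw [← vadd_mem_vadd_set_iff (a := x i), ← toExposed_vadd]
    exact ⟨hp', fun y hy => (h1 y hy).trans (h2 _ hj)⟩

/-- The faces of `K` in opposite directions are translates of each other. -/
lemma exists_opposite_faces (hK : IsConvexBody K)
    (hedge : ∀ g : StrongDual ℝ Plane, g ≠ 0 → (g.toExposed K).Nontrivial →
      ∃ e, HasEdgePair K g e) {u : StrongDual ℝ Plane} (hu : u ≠ 0) :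
    ∃ q r d, u.toExposed K = segment ℝ q (q + d) ∧ (-u).toExposed K = segment ℝ r (r + d) := by
  by_cases h : (u.toExposed K).Nontrivial
  · obtain ⟨e, -, -, q, r, hq, hr⟩ := hedge u hu h
    exact ⟨q, r, e, hq, hr⟩
  by_cases h' : ((-u).toExposed K).Nontrivial
  · obtain ⟨e, -, -, q, r, hq, hr⟩ := hedge (-u) (neg_ne_zero.2 hu) h'
    exact ⟨r, q, e, by rw [← hr, neg_neg], hq⟩
  have hsingle : ∀ w : StrongDual ℝ Plane, ¬ (w.toExposed K).Nontrivial →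
      ∃ q, w.toExposed K = {q} := by
    intro w hw
    obtain ⟨q, hq, hmax⟩ := hK.1.exists_isMaxOn (hK.2.2.mono interior_subset)
      w.continuous.continuousOn
    exact ⟨q, (not_nontrivial_iff.1 hw).eq_singleton_of_mem ⟨hq, hmax⟩⟩
  obtain ⟨q, hq⟩ := hsingle u h
  obtain ⟨r, hr⟩ := hsingle (-u) h'
  exact ⟨q, r, 0, by simp [hq], by simp [hr]⟩

/-- No four edges of a double tile point in pairwise nonparallel directions. -/
lemma exists_parallel_of_four [Nonempty ι] (hK : IsConvexBody K)
    (hT : IsDoubleCover (fun i => x i +ᵥ K))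
    (hedge : ∀ g : StrongDual ℝ Plane, g ≠ 0 → (g.toExposed K).Nontrivial →
      ∃ e, HasEdgePair K g e) (f : Fin 4 → StrongDual ℝ Plane) (hf : ∀ k, f k ≠ 0)
    (hfK : ∀ k, ((f k).toExposed K).Nontrivial) :
    ∃ k l, k ≠ l ∧ ∃ x, f k x = 0 ∧ f l x = 0 ∧ x ≠ 0 := by
  by_contra! hcon
  choose e he using fun k => hedge (f k) (hf k) (hfK k)
  refine hT.not_four_directions (fun i => hK.1.vadd (x i)) ?_ hcon
    (fun k i => (he k).vadd (x i))
  intro g hg i hn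
  obtain ⟨e, he⟩ := hedge g hg (by
    rw [toExposed_vadd] at hn
    obtain ⟨_, ⟨a, ha, rfl⟩, _, ⟨b, hb, rfl⟩, hab⟩ := hn
    exact ⟨a, ha, b, hb, fun h => hab (by rw [h])⟩)
  exact ⟨e, fun j => he.vadd (x j)⟩

end Tiling

theorem stmt_4 (K : Set (EuclideanSpace ℝ (Fin 2)))
    (hK : IsConvexBody K) (htile : IsKFoldTranslativeTile K 2) :
    (∃ c : EuclideanSpace ℝ (Fin 2), (fun y => (2 : ℝ) • c - y) '' K = K) ∧
    ∃ V : Finset (EuclideanSpace ℝ (Fin 2)), V.card ≤ 6 ∧ K = convexHull ℝ (V : Set _) := by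
  obtain ⟨ι, x, hfin, h2⟩ := htile
  replace h2 : ∀ p : Plane, (∀ i, p ∉ frontier (x i +ᵥ K)) →
      {i | p ∈ x i +ᵥ K}.encard = 2 := fun p hp => by simpa using h2 p hp
  have hT := hK.isDoubleCover hfin h2
  have : Nonempty ι := ⟨(hT.exists_pair 0).choose⟩
  have hedge : ∀ g : StrongDual ℝ Plane, g ≠ 0 → (g.toExposed K).Nontrivial →
      ∃ e, HasEdgePair K g e := fun g hg hn => exists_hasEdgePair hK hfin h2 hg hn
  obtain ⟨hEfin, hEcard⟩ := edges_finite_and_ncard_le (exists_parallel_of_four hK hT hedge)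
  obtain ⟨G, hG, hG0, hcov⟩ := exists_finite_faces hK hT
  obtain ⟨hV, hVcard⟩ := extremePoints_finite_and_ncard_le hEfin hEcard hedge fun v hv =>
    exists_two_edges hK.1.isClosed hK.2.1 hK.2.2 hG hG0 hcov hv
  have hKV : K = convexHull ℝ (K.extremePoints ℝ) := by
    conv_lhs => rw [← closure_convexHull_extremePoints hK.1 hK.2.1]
    exact (hV.isClosed_convexHull ℝ).closure_eq
  refine ⟨exists_image_eq (exists_sub_mem hK hV hKV Subset.rfl fun u hu =>
    exists_opposite_faces hK hedge hu), hV.toFinset, ?_, by rwa [hV.coe_toFinset]⟩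
  rwa [← ncard_eq_toFinset_card _ hV]
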